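/- Every element of 𝕊 lies in R₂^{SL₂}, and 𝕊 is a basis of R₂^{SL₂} as a free module over the subalgebra 𝒜. -/

import Mathlib

open MvPolynomial

noncomputable section

abbrev R2 (F : Type) [Field F] : Type := MvPolynomial (Fin 4) F

/-- The action of `A ∈ GL₂(F)` on `R₂ = F[x₁,x₂,y₁,y₂]` (variables `X 0, X 1, X 2, X 3`). -/
def act {F : Type} [Field F] (A : GL (Fin 2) F) : R2 F →ₐ[F] R2 F :=
  aeval ![C ((A.val.det)⁻¹ * A.val 1 1) * X 0 - C ((A.val.det)⁻¹ * A.val 1 0) * X 1,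
          C ((A.val.det)⁻¹ * A.val 0 0) * X 1 - C ((A.val.det)⁻¹ * A.val 0 1) * X 0,
          C (A.val 0 0) * X 2 + C (A.val 0 1) * X 3,
          C (A.val 1 0) * X 2 + C (A.val 1 1) * X 3]

/-- The invariant ring `R₂^G` for a subgroup `G ≤ GL₂(F)`. -/
def invariantRing {F : Type} [Field F] (G : Subgroup (GL (Fin 2) F)) : Subalgebra F (R2 F) where
  carrier := {f | ∀ A ∈ G, act A f = f}
  mul_mem' := fun hf hg A hA => by rw [map_mul, hf A hA, hg A hA]
  add_mem' := fun hf hg A hA => by rw [map_add, hf A hA, hg A hA]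
  one_mem' := fun A _ => map_one (act A)
  zero_mem' := fun A _ => map_zero (act A)
  algebraMap_mem' := fun r A _ => (act A).commutes r

/-- `SL₂(F)` as a subgroup of `GL₂(F)`. -/
def SL2 (F : Type) [Field F] : Subgroup (GL (Fin 2) F) where
  carrier := {A | A.val.det = 1}
  one_mem' := by simp
  mul_mem' := by
    intro a b ha hb
    simp only [Set.mem_setOf_eq, Units.val_mul, Matrix.det_mul] at *
    rw [ha, hb, mul_one]
  inv_mem' := by
    intro a ha
    have h : ((a⁻¹).val * a.val).det = 1 := by
      rw [← Units.val_mul, inv_mul_cancel, Units.val_one, Matrix.det_one]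
    simp only [Matrix.det_mul] at h
    rw [Set.mem_setOf_eq] at ha ⊢
    rw [ha, mul_one] at h
    exact h

/-- `P₂(F)`: upper triangular matrices in `SL₂(F)` with 1's on the diagonal. -/
def P2 (F : Type) [Field F] : Subgroup (GL (Fin 2) F) where
  carrier := {A | A.val 0 0 = 1 ∧ A.val 1 1 = 1 ∧ A.val 1 0 = 0}
  one_mem' := by simp
  mul_mem' := by
    intro a b ha hb
    obtain ⟨ha1, ha2, ha3⟩ := ha
    obtain ⟨hb1, hb2, hb3⟩ := hb
    refine ⟨?_, ?_, ?_⟩ <;>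
      simp [Units.val_mul, Matrix.mul_apply, Fin.sum_univ_two, ha1, ha2, ha3, hb1, hb2, hb3]
  inv_mem' := by
    intro a ha
    obtain ⟨ha1, ha2, ha3⟩ := ha
    have hdet : a.val.det = 1 := by
      rw [Matrix.det_fin_two, ha1, ha2, ha3]; ring
    have hinv : (a⁻¹).val = a.val⁻¹ := by
      simp [Matrix.coe_units_inv]
    refine ⟨?_, ?_, ?_⟩ <;>
      simp [hinv, Matrix.inv_def, hdet, Matrix.adjugate_fin_two, ha1, ha2, ha3]

def d22 (F : Type) [Field F] (q : ℕ) : R2 F := X 1 * X 0 ^ q - X 0 * X 1 ^ q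
def d22s (F : Type) [Field F] (q : ℕ) : R2 F := X 2 * X 3 ^ q - X 3 * X 2 ^ q
def u0 (F : Type) [Field F] : R2 F := X 0 * X 2 + X 1 * X 3
def u1 (F : Type) [Field F] (q : ℕ) : R2 F := X 0 ^ q * X 2 + X 1 ^ q * X 3
def u1s (F : Type) [Field F] (q : ℕ) : R2 F := X 0 * X 2 ^ q + X 1 * X 3 ^ q
def phi1 (F : Type) [Field F] : R2 F := X 0
def phi2 (F : Type) [Field F] (q : ℕ) : R2 F := X 1 ^ q - X 1 * X 0 ^ (q - 1)
def phi1s (F : Type) [Field F] : R2 F := X 3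
def phi2s (F : Type) [Field F] (q : ℕ) : R2 F := X 2 ^ q - X 2 * X 3 ^ (q - 1)

namespace FiniteField

variable (F : Type*) [Field F] [Fintype F] {R : Type*} [CommRing R] [Algebra F R]

theorem algebra_add_pow_card (x y : R) :
    (x + y) ^ Fintype.card F = x ^ Fintype.card F + y ^ Fintype.card F :=
  map_add (frobeniusAlgHom F R) x y

theorem algebra_sub_pow_card (x y : R) :
    (x - y) ^ Fintype.card F = x ^ Fintype.card F - y ^ Fintype.card F :=
  map_sub (frobeniusAlgHom F R) x y

variable {F} in
theorem smul_pow_card (a : F) (x : R) :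
    (a • x) ^ Fintype.card F = a • x ^ Fintype.card F :=
  map_smul (frobeniusAlgHom F R) a x

end FiniteField

namespace Polynomial

theorem natDegree_X_pow_sub_C_mul_X {B : Type*} [CommRing B] [Nontrivial B] {n : ℕ} (hn : 1 < n)
    (b : B) : (X ^ n - C b * X : Polynomial B).natDegree = n := by
  rw [natDegree_sub_eq_left_of_natDegree_lt] <;> rw [natDegree_X_pow]
  exact lt_of_le_of_lt ((natDegree_C_mul_le _ _).trans natDegree_X_le) hn

theorem X_pow_sub_C_mul_X_dvd {F B : Type*} [Field F] [Fintype F] [CommRing B]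
    [IsDomain B] [Algebra F B] {t : B} (ht : t ≠ 0) (p : Polynomial B)
    (hp : ∀ a : F, p.eval (a • t) = 0) :
    (X ^ Fintype.card F - C (t ^ (Fintype.card F - 1)) * X : Polynomial B) ∣ p := by
  have hq : 1 < Fintype.card F := Fintype.one_lt_card
  set N : Polynomial B := X ^ Fintype.card F - C (t ^ (Fintype.card F - 1)) * X with hN
  have hdeg : (C (t ^ (Fintype.card F - 1)) * X : Polynomial B).degree < Fintype.card F :=
    lt_of_le_of_lt (degree_C_mul_X_le _) (by exact_mod_cast hq)
  have hmonic : N.Monic := monic_X_pow_sub hdeg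
  have hnat : N.natDegree = Fintype.card F := natDegree_X_pow_sub_C_mul_X hq _
  rw [← modByMonic_eq_zero_iff_dvd hmonic]
  refine eq_zero_of_natDegree_lt_card_of_eval_eq_zero _ (f := fun a : F => a • t)
    (smul_left_injective F ht) (fun a => ?_) ?_
  · have h1 := congrArg (eval (a • t)) (modByMonic_add_div p N)
    have h2 : N.eval (a • t) = 0 := by
      simp only [hN, eval_sub, eval_pow, eval_X, eval_mul, eval_C]
      rw [FiniteField.smul_pow_card, mul_smul_comm, ← pow_succ, Nat.sub_add_cancel hq.le, sub_self]
    simpa [h2, hp a] using h1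
  · rw [← hnat]
    refine natDegree_modByMonic_lt _ hmonic fun h => ?_
    rw [h, natDegree_one] at hnat
    omega

theorem dvd_coeff_of_comp_eq {F B : Type*} [Field F] [Fintype F] [CommRing B]
    [IsDomain B] [Algebra F B] {t : B} (ht : t ≠ 0) (p : Polynomial B)
    (hp : ∀ a : F, p.comp (X + C (a • t)) = p) (i : ℕ) (hi : ¬ Fintype.card F ∣ i) :
    t ∣ p.coeff i := by
  have hq : 1 < Fintype.card F := Fintype.one_lt_card
  induction hn : p.natDegree using Nat.strong_induction_on generalizing p i with
  | _ n ih =>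
  obtain ⟨Q, hQ⟩ := X_pow_sub_C_mul_X_dvd (F := F) ht (p - C (p.eval 0)) (fun a => by
    have := congrArg (eval 0) (hp a)
    simp only [eval_comp, eval_add, eval_X, eval_C, zero_add] at this
    simp [this])
  set N : Polynomial B := X ^ Fintype.card F - C (t ^ (Fintype.card F - 1)) * X with hN
  have hi0 : i ≠ 0 := by rintro rfl; exact hi (dvd_zero _)
  have hcoeff : p.coeff i = (N * Q).coeff i := by
    rw [← hQ, coeff_sub, coeff_C, if_neg hi0, sub_zero]
  have hNnat : N.natDegree = Fintype.card F := natDegree_X_pow_sub_C_mul_X hq _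
  have hN0 : N ≠ 0 := by
    intro h
    rw [h, natDegree_zero] at hNnat
    omega
  rw [hcoeff]
  by_cases hQ0 : Q = 0
  · simp [hQ0]
  have hcomp : ∀ a : F, N.comp (X + C (a • t)) = N := fun a => by
    simp only [hN, sub_comp, pow_comp, X_comp, mul_comp, C_comp]
    rw [FiniteField.algebra_add_pow_card, mul_add, ← C_mul, ← C_pow, FiniteField.smul_pow_card,
      mul_smul_comm, ← pow_succ, Nat.sub_add_cancel hq.le]
    ring
  have hQinv : ∀ a : F, Q.comp (X + C (a • t)) = Q := fun a => by
    have h1 := congrArg (fun r => r.comp (X + C (a • t))) hQ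
    simp only [sub_comp, hp a, C_comp, mul_comp, hcomp] at h1
    exact (mul_left_cancel₀ hN0 (hQ.symm.trans h1)).symm
  have hlt : Q.natDegree < n := by
    have h1 := congrArg natDegree hQ
    rw [natDegree_sub_C, natDegree_mul hN0 hQ0, hNnat, hn] at h1
    omega
  have hsplit : N * Q = X ^ Fintype.card F * Q - C (t ^ (Fintype.card F - 1)) * (X * Q) := by
    rw [hN]; ring
  rw [hsplit, coeff_sub]
  refine dvd_sub ?_ ?_
  · rw [coeff_X_pow_mul']
    split_ifs with h
    · exact ih _ hlt Q hQinv _ (fun h' => hi ((Nat.dvd_sub_iff_left h dvd_rfl).1 h')) rfl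
    · exact dvd_zero _
  · rw [coeff_C_mul]
    exact Dvd.dvd.mul_right (dvd_pow_self t (by omega)) _

end Polynomial

section actions
variable {F : Type} [Field F]

/-- The action of the matrix `[[a, b], [c, d]]` on the variables `x₁, x₂` alone. -/
def actX (a b c d : F) : R2 F →ₐ[F] R2 F :=
  aeval ![C d * X 0 - C c * X 1, C a * X 1 - C b * X 0, X 2, X 3]

/-- The action of the matrix `[[a, b], [c, d]]` of determinant one on all four variables. -/
def actXY (a b c d : F) : R2 F →ₐ[F] R2 F :=
  aeval ![C d * X 0 - C c * X 1, C a * X 1 - C b * X 0, C a * X 2 + C b * X 3,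
    C c * X 2 + C d * X 3]

/-- The exchange of `x₁, x₂` with `y₂, y₁`. -/
def swapXY : R2 F →ₐ[F] R2 F := rename Fin.rev

section values
variable (a b c d : F)
@[simp] theorem actX_X0 : actX a b c d (X 0) = C d * X 0 - C c * X 1 := by simp [actX]
@[simp] theorem actX_X1 : actX a b c d (X 1) = C a * X 1 - C b * X 0 := by simp [actX]
@[simp] theorem actX_X2 : actX a b c d (X 2) = X 2 := by simp [actX]
@[simp] theorem actX_X3 : actX a b c d (X 3) = X 3 := by simp [actX]
@[simp] theorem actXY_X0 : actXY a b c d (X 0) = C d * X 0 - C c * X 1 := by simp [actXY]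
@[simp] theorem actXY_X1 : actXY a b c d (X 1) = C a * X 1 - C b * X 0 := by simp [actXY]
@[simp] theorem actXY_X2 : actXY a b c d (X 2) = C a * X 2 + C b * X 3 := by simp [actXY]
@[simp] theorem actXY_X3 : actXY a b c d (X 3) = C c * X 2 + C d * X 3 := by simp [actXY]
@[simp] theorem swapXY_X0 : swapXY (X 0 : R2 F) = X 3 := by simp [swapXY]
@[simp] theorem swapXY_X1 : swapXY (X 1 : R2 F) = X 2 := by simp [swapXY]
@[simp] theorem swapXY_X2 : swapXY (X 2 : R2 F) = X 1 := by simp [swapXY]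
@[simp] theorem swapXY_X3 : swapXY (X 3 : R2 F) = X 0 := by simp [swapXY]
end values

theorem swapXY_swapXY (f : R2 F) : swapXY (swapXY f) = f := by
  have : (swapXY.comp swapXY : R2 F →ₐ[F] R2 F) = AlgHom.id F _ := by
    ext i; fin_cases i <;> simp
  exact DFunLike.congr_fun this f

theorem swapXY_actXY (a b c d : F) (f : R2 F) :
    swapXY (actXY a b c d f) = actXY a (-b) (-c) d (swapXY f) := by
  have : (swapXY.comp (actXY a b c d)) = (actXY a (-b) (-c) d).comp swapXY := by
    apply algHom_ext
    intro i; fin_cases i <;> simp [swapXY, Fin.rev] <;> ring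
  exact DFunLike.congr_fun this f

theorem mem_invariantRing_SL2_iff {f : R2 F} : f ∈ invariantRing (SL2 F) ↔
    ∀ a b c d : F, a * d - b * c = 1 → actXY a b c d f = f := by
  have key : ∀ A : GL (Fin 2) F, A.val.det = 1 →
      act A = actXY (A.val 0 0) (A.val 0 1) (A.val 1 0) (A.val 1 1) := by
    intro A hA
    apply algHom_ext
    intro i
    fin_cases i <;> simp [act, actXY, hA]
  constructor
  · intro hf a b c d h
    have hdet : (!![a, b; c, d] : Matrix (Fin 2) (Fin 2) F).det = 1 := by
      rw [Matrix.det_fin_two_of, h]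
    have h1 := hf (Matrix.GeneralLinearGroup.mkOfDetNeZero !![a, b; c, d] (by simp [hdet])) hdet
    rw [key _ hdet] at h1
    simpa [Matrix.GeneralLinearGroup.mkOfDetNeZero] using h1
  · intro hf A hA
    rw [key A hA]
    exact hf _ _ _ _ (by rw [← Matrix.det_fin_two]; exact hA)

theorem swapXY_mem_invariantRing {f : R2 F} (hf : f ∈ invariantRing (SL2 F)) :
    swapXY f ∈ invariantRing (SL2 F) := by
  rw [mem_invariantRing_SL2_iff] at hf ⊢
  intro a b c d h
  have h1 := hf a (-b) (-c) d (by rw [← h]; ring)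
  conv_rhs => rw [← h1, swapXY_actXY, neg_neg, neg_neg]

@[simp] theorem swapXY_d22 (q : ℕ) : swapXY (d22 F q) = d22s F q := by simp [d22, d22s]
@[simp] theorem swapXY_d22s (q : ℕ) : swapXY (d22s F q) = d22 F q := by simp [d22, d22s]
@[simp] theorem swapXY_u0 : swapXY (u0 F) = u0 F := by simp [u0]; ring
@[simp] theorem swapXY_u1 (q : ℕ) : swapXY (u1 F q) = u1s F q := by simp [u1, u1s]; ring
@[simp] theorem swapXY_u1s (q : ℕ) : swapXY (u1s F q) = u1 F q := by simp [u1, u1s]; ring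

theorem u0_ne_zero : u0 F ≠ 0 := by
  intro h
  have := congrArg (aeval (![1, 0, 1, 0] : Fin 4 → F)) h
  simp [u0] at this

theorem actXY_u0 {a b c d : F} (h : a * d - b * c = 1) : actXY a b c d (u0 F) = u0 F := by
  have h' : (C a * C d - C b * C c : R2 F) = 1 := by
    rw [← C_mul, ← C_mul, ← C_sub, h, C_1]
  simp only [u0, map_add, map_mul, actXY_X0, actXY_X1, actXY_X2, actXY_X3]
  linear_combination (X 0 * X 2 + X 1 * X 3) * h'

theorem u0_mem : u0 F ∈ invariantRing (SL2 F) :=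
  mem_invariantRing_SL2_iff.2 fun _ _ _ _ h => actXY_u0 h

section finite
variable [Fintype F] {q : ℕ}

theorem C_mul_sub_C_mul_pow (hF : Fintype.card F = q) (a b : F) (x y : R2 F) :
    (C a * x - C b * y) ^ q = C a * x ^ q - C b * y ^ q := by
  subst hF
  rw [FiniteField.algebra_sub_pow_card, mul_pow, mul_pow, ← C_pow, ← C_pow,
    FiniteField.pow_card, FiniteField.pow_card]

theorem one_lt_of_card (hF : Fintype.card F = q) : 1 < q := hF ▸ Fintype.one_lt_card

theorem d22_ne_zero (hF : Fintype.card F = q) : d22 F q ≠ 0 := by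
  intro h
  have := congrArg (aeval (![Polynomial.X, 1, 0, 0] : Fin 4 → Polynomial F)) h
  simp [d22] at this
  exact FiniteField.X_pow_card_sub_X_ne_zero F (one_lt_of_card hF) this

theorem d22s_ne_zero (hF : Fintype.card F = q) : d22s F q ≠ 0 := by
  intro h
  apply d22_ne_zero hF
  rw [← swapXY_d22s, h, map_zero]

theorem actX_d22 (hF : Fintype.card F = q) {a b c d : F}
    (h : a * d - b * c = 1) : actX a b c d (d22 F q) = d22 F q := by
  have h' : (C a * C d - C b * C c : R2 F) = 1 := by
    rw [← C_mul, ← C_mul, ← C_sub, h, C_1]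
  simp only [d22, map_sub, map_mul, map_pow, actX_X0, actX_X1, C_mul_sub_C_mul_pow hF]
  linear_combination (X 1 * X 0 ^ q - X 0 * X 1 ^ q) * h'

theorem actX_c21 (hF : Fintype.card F = q) {a b c d : F}
    (h : a * d - b * c = 1) {c21 : R2 F}
    (hc : d22 F q * c21 = X 1 * X 0 ^ (q ^ 2) - X 0 * X 1 ^ (q ^ 2)) :
    actX a b c d c21 = c21 := by
  have h' : (C a * C d - C b * C c : R2 F) = 1 := by
    rw [← C_mul, ← C_mul, ← C_sub, h, C_1]
  apply mul_left_cancel₀ (d22_ne_zero hF)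
  have := congrArg (actX a b c d) hc
  rw [map_mul, actX_d22 hF h] at this
  rw [this, hc]
  simp only [map_sub, map_mul, map_pow, actX_X0, actX_X1, pow_two, pow_mul,
    C_mul_sub_C_mul_pow hF]
  linear_combination (X 1 * (X 0 ^ q) ^ q - X 0 * (X 1 ^ q) ^ q) * h'

theorem actXY_u1 (hF : Fintype.card F = q) {a b c d : F}
    (h : a * d - b * c = 1) : actXY a b c d (u1 F q) = u1 F q := by
  have h' : (C a * C d - C b * C c : R2 F) = 1 := by
    rw [← C_mul, ← C_mul, ← C_sub, h, C_1]
  simp only [u1, map_add, map_mul, map_pow, actXY_X0, actXY_X1, actXY_X2, actXY_X3,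
    C_mul_sub_C_mul_pow hF]
  linear_combination (X 0 ^ q * X 2 + X 1 ^ q * X 3) * h'

theorem actXY_d22 (hF : Fintype.card F = q) {a b c d : F}
    (h : a * d - b * c = 1) : actXY a b c d (d22 F q) = d22 F q := by
  have h' : (C a * C d - C b * C c : R2 F) = 1 := by
    rw [← C_mul, ← C_mul, ← C_sub, h, C_1]
  simp only [d22, map_sub, map_mul, map_pow, actXY_X0, actXY_X1, C_mul_sub_C_mul_pow hF]
  linear_combination (X 1 * X 0 ^ q - X 0 * X 1 ^ q) * h'

theorem u1_mem (hF : Fintype.card F = q) : u1 F q ∈ invariantRing (SL2 F) :=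
  mem_invariantRing_SL2_iff.2 fun _ _ _ _ h => actXY_u1 hF h

theorem d22_mem (hF : Fintype.card F = q) : d22 F q ∈ invariantRing (SL2 F) :=
  mem_invariantRing_SL2_iff.2 fun _ _ _ _ h => actXY_d22 hF h

theorem u1s_mem (hF : Fintype.card F = q) : u1s F q ∈ invariantRing (SL2 F) := by
  rw [← swapXY_u1]; exact swapXY_mem_invariantRing (u1_mem hF)

theorem d22s_mem (hF : Fintype.card F = q) : d22s F q ∈ invariantRing (SL2 F) := by
  rw [← swapXY_d22]; exact swapXY_mem_invariantRing (d22_mem hF)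
end finite

end actions

section Dickson
variable {F : Type} [Field F]

theorem monomial_fin_four (m : Fin 4 →₀ ℕ) (r : F) : (monomial m r : R2 F) =
    C r * (X 0 ^ m 0 * X 1 ^ m 1 * X 2 ^ m 2 * X 3 ^ m 3) := by
  rw [monomial_eq, Finsupp.prod_fintype _ _ (fun _ => pow_zero _), Fin.prod_univ_four]

theorem coeff_actX_diagonal {a b : F} (m : Fin 4 →₀ ℕ) (f : R2 F) :
    coeff m (actX b 0 0 a f) = a ^ m 0 * b ^ m 1 * coeff m f := by
  induction f using MvPolynomial.induction_on' with
  | monomial u r =>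
    have : actX b 0 0 a (monomial u r) = monomial u (a ^ u 0 * b ^ u 1 * r) := by
      rw [monomial_fin_four, monomial_fin_four]
      simp [mul_pow, algHom_C]
      ring
    rw [this, coeff_monomial, coeff_monomial]
    split_ifs with h
    · rw [h]
    · simp
  | add p q hp hq => rw [map_add, coeff_add, hp, hq, coeff_add, mul_add]

theorem finSuccEquiv_X_one : finSuccEquiv F 3 (X 1) = Polynomial.C (X 0) :=
  finSuccEquiv_X_succ (j := 0)

theorem finSuccEquiv_X_two : finSuccEquiv F 3 (X 2) = Polynomial.C (X 1) :=
  finSuccEquiv_X_succ (j := 1)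

theorem finSuccEquiv_X_three : finSuccEquiv F 3 (X 3) = Polynomial.C (X 2) :=
  finSuccEquiv_X_succ (j := 2)

theorem finSuccEquiv_C (r : F) : finSuccEquiv F 3 (C r) = Polynomial.C (C r) := by
  simp [finSuccEquiv_apply]

theorem finSuccEquiv_actX_unipotent (c : F) (f : R2 F) :
    finSuccEquiv F 3 (actX 1 0 c 1 f) = (finSuccEquiv F 3 f).comp
      (Polynomial.X + Polynomial.C ((-c) • (X 0 : MvPolynomial (Fin 3) F))) := by
  induction f using MvPolynomial.induction_on with
  | C r => simp [algHom_C, finSuccEquiv_apply]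
  | add p q hp hq => rw [map_add, map_add, hp, hq, map_add, Polynomial.add_comp]
  | mul_X p i hp =>
    have key : finSuccEquiv F 3 (actX 1 0 c 1 (X i)) = (finSuccEquiv F 3 (X i)).comp
        (Polynomial.X + Polynomial.C ((-c) • (X 0 : MvPolynomial (Fin 3) F))) := by
      fin_cases i
      · simp [finSuccEquiv_X_zero, finSuccEquiv_X_one, finSuccEquiv_C, smul_eq_C_mul,
          sub_eq_add_neg]
      · simp [finSuccEquiv_X_one]
      · simp [finSuccEquiv_X_two]
      · simp [finSuccEquiv_X_three]
    rw [map_mul, map_mul, hp, map_mul, Polynomial.mul_comp, key]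

variable [Fintype F] {q : ℕ}

theorem dvd_of_coeff_ne_zero (hF : Fintype.card F = q) {f : R2 F}
    (hf : ∀ a b c d : F, a * d - b * c = 1 → actX a b c d f = f) {m : Fin 4 →₀ ℕ}
    (hm : coeff m f ≠ 0) (hm1 : m 1 = 0) : q * (q - 1) ∣ m 0 := by
  have hq := one_lt_of_card hF
  refine Nat.Coprime.mul_dvd_of_dvd_of_dvd ?_ ?_ ?_
  · exact (Nat.coprime_self_sub_right hq.le).2 (Nat.coprime_one_right q)
  · by_contra hndvd
    subst hF
    have h1 := Polynomial.dvd_coeff_of_comp_eq (F := F) (t := (X 0 : MvPolynomial (Fin 3) F))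
      (X_ne_zero 0) (finSuccEquiv F 3 f) (fun a => by
        rw [← neg_neg a, ← finSuccEquiv_actX_unipotent, hf _ _ _ _ (by simp)]) (m 0) hndvd
    apply hm
    rw [← Finsupp.cons_tail m, ← finSuccEquiv_coeff_coeff]
    obtain ⟨r, hr⟩ := h1
    rw [hr, mul_comm, coeff_mul_X', if_neg]
    rw [Finsupp.notMem_support_iff, Finsupp.tail_apply]
    exact hm1
  · subst hF
    rw [← FiniteField.forall_pow_eq_one_iff]
    intro a
    have h1 := coeff_actX_diagonal (a := (a : F)) (b := (a⁻¹ : Fˣ)) m f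
    rw [hf _ _ _ _ (by simp), hm1, pow_zero, mul_one] at h1
    have h2 := mul_right_cancel₀ hm ((one_mul _).trans h1)
    ext
    simpa using h2.symm

theorem X_one_dvd_c21_sub (hF : Fintype.card F = q) {c21 : R2 F}
    (hc : d22 F q * c21 = X 1 * X 0 ^ (q ^ 2) - X 0 * X 1 ^ (q ^ 2)) :
    (X 1 : R2 F) ∣ c21 - X 0 ^ (q * (q - 1)) := by
  have hq := one_lt_of_card hF
  have hp : Prime (X 1 : R2 F) := X_prime
  have h1 : (X 1 : R2 F) ∣ X 0 ^ q * (c21 - X 0 ^ (q * (q - 1))) := by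
    refine ⟨X 0 * X 1 ^ (q - 2) * c21 - X 0 * X 1 ^ (q ^ 2 - 2), ?_⟩
    apply mul_left_cancel₀ hp.ne_zero
    rw [d22] at hc
    have e1 : (X 1 : R2 F) ^ q = X 1 * X 1 * X 1 ^ (q - 2) := by
      rw [← pow_two, ← pow_add]; congr 1; omega
    have e2 : (X 1 : R2 F) ^ (q ^ 2) = X 1 * X 1 * X 1 ^ (q ^ 2 - 2) := by
      rw [← pow_two, ← pow_add]; congr 1; have : 2 ≤ q ^ 2 := by nlinarith
      omega
    have e3 : (X 0 : R2 F) ^ (q ^ 2) = X 0 ^ q * X 0 ^ (q * (q - 1)) := by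
      rw [← pow_add]; congr 1
      obtain ⟨r, rfl⟩ := Nat.exists_eq_add_of_lt hq
      simp; ring
    rw [e1, e2, e3] at hc
    linear_combination hc
  refine (hp.dvd_or_dvd h1).resolve_left fun h2 => ?_
  have h3 := hp.dvd_of_dvd_pow h2
  rw [X_dvd_X] at h3
  simp at h3

theorem d22_dvd_of_X_one_dvd (hF : Fintype.card F = q) {w : R2 F}
    (hw : ∀ a b c d : F, a * d - b * c = 1 → actX a b c d w = w) (h1 : X 1 ∣ w) :
    d22 F q ∣ w := by
  have hq := one_lt_of_card hF
  obtain ⟨w₁, rfl⟩ := h1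
  have hX : (X 0 : MvPolynomial (Fin 3) F) ≠ 0 := X_ne_zero 0
  have heval : ∀ a : F, (finSuccEquiv F 3 w₁).eval (a • (X 0 : MvPolynomial (Fin 3) F)) = 0 := by
    intro a
    have h2 := congrArg (fun p => (finSuccEquiv F 3 p).eval (a • (X 0 : MvPolynomial (Fin 3) F)))
      (hw (-a) (-1) 1 0 (by simp))
    simp only [map_mul, actX_X1, map_sub, finSuccEquiv_X_zero,
      finSuccEquiv_X_one, finSuccEquiv_C, Polynomial.eval_mul,
      Polynomial.eval_sub, Polynomial.eval_C, Polynomial.eval_X, smul_eq_C_mul] at h2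
    rw [smul_eq_C_mul]
    refine (mul_eq_zero.1 (h2.symm.trans ?_)).resolve_left hX
    rw [C_neg, C_neg, C_1]
    ring
  subst hF
  obtain ⟨r, hr⟩ := Polynomial.X_pow_sub_C_mul_X_dvd (F := F) hX _ heval
  refine ⟨(finSuccEquiv F 3).symm r, (finSuccEquiv F 3).injective ?_⟩
  have e5 : finSuccEquiv F 3 (d22 F (Fintype.card F)) = Polynomial.C (X 0) *
      (Polynomial.X ^ Fintype.card F -
        Polynomial.C (X 0 ^ (Fintype.card F - 1)) * Polynomial.X) := by
    simp only [d22, map_sub, map_mul, map_pow, finSuccEquiv_X_one, finSuccEquiv_X_zero]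
    rw [mul_sub, ← mul_assoc, ← pow_succ', Nat.sub_add_cancel hq.le, mul_comm Polynomial.X]
  rw [map_mul, map_mul, hr, e5, AlgEquiv.apply_symm_apply, finSuccEquiv_X_one, mul_assoc]

theorem totalDegree_d22 (hF : Fintype.card F = q) : (d22 F q).totalDegree = q + 1 := by
  refine IsHomogeneous.totalDegree ?_ (d22_ne_zero hF)
  have h1 : ∀ i j : Fin 4, (X i * X j ^ q : R2 F).IsHomogeneous (q + 1) := fun i j => by
    rw [add_comm q 1]
    simpa using (isHomogeneous_X F i).mul ((isHomogeneous_X F j).pow q)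
  exact (h1 1 0).sub (h1 0 1)

theorem totalDegree_c21_le (hF : Fintype.card F = q) {c21 : R2 F}
    (hc : d22 F q * c21 = X 1 * X 0 ^ (q ^ 2) - X 0 * X 1 ^ (q ^ 2)) :
    c21.totalDegree ≤ q * (q - 1) := by
  by_cases h0 : c21 = 0
  · simp [h0]
  have hq := one_lt_of_card hF
  have h1 : ∀ i j : Fin 4, (X i * X j ^ (q ^ 2) : R2 F).totalDegree ≤ q ^ 2 + 1 := fun i j => by
    rw [add_comm]
    refine (totalDegree_mul _ _).trans (add_le_add (totalDegree_X _).le ?_)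
    exact (totalDegree_pow _ _).trans (by simp)
  have h2 := (totalDegree_sub _ _).trans (max_le (h1 1 0) (h1 0 1))
  rw [← hc, totalDegree_mul_of_isDomain (d22_ne_zero hF) h0, totalDegree_d22 hF] at h2
  rw [Nat.mul_sub, mul_one]
  have : q * q = q ^ 2 := (pow_two q).symm
  omega

/-- Dickson's theorem for `SL₂(F)`, with two spectator variables. -/
theorem mem_adjoin_of_actX_eq (hF : Fintype.card F = q) {c21 : R2 F}
    (hc : d22 F q * c21 = X 1 * X 0 ^ (q ^ 2) - X 0 * X 1 ^ (q ^ 2)) (f : R2 F)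
    (hf : ∀ a b c d : F, a * d - b * c = 1 → actX a b c d f = f) :
    f ∈ Algebra.adjoin F {d22 F q, c21, X 2, X 3} := by
  induction hn : f.totalDegree using Nat.strong_induction_on generalizing f with
  | _ n ih =>
  have hq := one_lt_of_card hF
  set T := Algebra.adjoin F {d22 F q, c21, X 2, X 3} with hT
  have hd : d22 F q ∈ T := Algebra.subset_adjoin (by simp)
  have hcT : c21 ∈ T := Algebra.subset_adjoin (by simp)
  have h2 : X 2 ∈ T := Algebra.subset_adjoin (by simp)
  have h3 : X 3 ∈ T := Algebra.subset_adjoin (by simp)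
  set g : (Fin 4 →₀ ℕ) → R2 F := fun m =>
    if m 1 = 0 then C (coeff m f) * (c21 ^ (m 0 / (q * (q - 1))) * X 2 ^ m 2 * X 3 ^ m 3) else 0
    with hg
  have hgT : ∀ m, g m ∈ T := fun m => by
    simp only [hg]
    split_ifs
    · exact T.mul_mem (T.algebraMap_mem _)
        (T.mul_mem (T.mul_mem (T.pow_mem hcT _) (T.pow_mem h2 _)) (T.pow_mem h3 _))
    · exact T.zero_mem
  have hginv : ∀ a b c d : F, a * d - b * c = 1 → ∀ m, actX a b c d (g m) = g m := by
    intro a b c d h m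
    simp only [hg]
    split_ifs
    · simp [algHom_C, actX_c21 hF h hc]
    · simp
  have hgdeg : ∀ m ∈ f.support, (g m).totalDegree ≤ n := fun m hm => by
    simp only [hg]
    split_ifs with h
    · have hm0 := Nat.div_mul_cancel (dvd_of_coeff_ne_zero hF hf (mem_support_iff.1 hm) h)
      have hle := le_totalDegree hm
      rw [Finsupp.sum_fintype _ _ (fun _ => rfl), Fin.sum_univ_four, h, hn] at hle
      refine (totalDegree_mul _ _).trans ?_
      rw [totalDegree_C, zero_add]
      refine (totalDegree_mul _ _).trans ?_
      have e3 : (X 3 ^ m 3 : R2 F).totalDegree ≤ m 3 := by simp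
      have e2 : (X 2 ^ m 2 : R2 F).totalDegree ≤ m 2 := by simp
      have e1 : (c21 ^ (m 0 / (q * (q - 1)))).totalDegree ≤ m 0 := by
        refine (totalDegree_pow _ _).trans ?_
        calc _ ≤ _ := Nat.mul_le_mul_left _ (totalDegree_c21_le hF hc)
          _ = _ := hm0
      have e4 := totalDegree_mul (c21 ^ (m 0 / (q * (q - 1)))) (X 2 ^ m 2)
      omega
    · simp
  set G := ∑ m ∈ f.support, g m with hG
  have hGT : G ∈ T := T.sum_mem fun m _ => hgT m
  have hGdeg : G.totalDegree ≤ n := totalDegree_finsetSum_le hgdeg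
  have hdvd : X 1 ∣ f - G := by
    conv_rhs => rw [f.as_sum, hG, ← Finset.sum_sub_distrib]
    refine Finset.dvd_sum fun m hm => ?_
    rw [monomial_fin_four]
    simp only [hg]
    split_ifs with h
    · obtain ⟨k, hk⟩ := dvd_of_coeff_ne_zero hF hf (mem_support_iff.1 hm) h
      have hpos : 0 < q * (q - 1) := Nat.mul_pos (by omega) (by omega)
      rw [h, hk, Nat.mul_div_cancel_left _ hpos, pow_mul]
      have h5 : (X 1 : R2 F) ∣ (X 0 ^ (q * (q - 1))) ^ k - c21 ^ k :=
        ((dvd_sub_comm).1 (X_one_dvd_c21_sub hF hc)).trans (sub_dvd_pow_sub_pow _ _ k)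
      obtain ⟨r, hr⟩ := h5
      refine ⟨C (coeff m f) * (r * X 2 ^ m 2 * X 3 ^ m 3), ?_⟩
      linear_combination C (coeff m f) * X 2 ^ m 2 * X 3 ^ m 3 * hr
    · rw [sub_zero]
      exact (((dvd_pow_self _ h).mul_left _).mul_right _ |>.mul_right _).mul_left _
  have hinv : ∀ a b c d : F, a * d - b * c = 1 → actX a b c d (f - G) = f - G := by
    intro a b c d h
    rw [map_sub, hf a b c d h, hG, map_sum, Finset.sum_congr rfl fun m _ => hginv a b c d h m]
  obtain ⟨r, hr⟩ := d22_dvd_of_X_one_dvd hF hinv hdvd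
  have hfr : f = G + d22 F q * r := by rw [← hr]; ring
  rw [hfr]
  refine T.add_mem hGT (T.mul_mem hd ?_)
  by_cases hr0 : r = 0
  · rw [hr0]; exact T.zero_mem
  refine ih r.totalDegree ?_ r (fun a b c d h => ?_) rfl
  · have h6 := (totalDegree_sub f G).trans (max_le hn.le hGdeg)
    rw [hr, totalDegree_mul_of_isDomain (d22_ne_zero hF) hr0, totalDegree_d22 hF] at h6
    omega
  · have h7 := hinv a b c d h
    rw [hr, map_mul, actX_d22 hF h] at h7
    exact mul_left_cancel₀ (d22_ne_zero hF) h7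

end Dickson

section localization
variable {F : Type} [Field F]

/-- The substitution `y₁ ↦ u₀`, `y₂ ↦ u₁`. -/
def substU (q : ℕ) : R2 F →ₐ[F] R2 F := aeval ![X 0, X 1, u0 F, u1 F q]

@[simp] theorem substU_X0 (q : ℕ) : substU q (X 0 : R2 F) = X 0 := by simp [substU]
@[simp] theorem substU_X1 (q : ℕ) : substU q (X 1 : R2 F) = X 1 := by simp [substU]
@[simp] theorem substU_X2 (q : ℕ) : substU q (X 2 : R2 F) = u0 F := by simp [substU]
@[simp] theorem substU_X3 (q : ℕ) : substU q (X 3 : R2 F) = u1 F q := by simp [substU]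

theorem substU_d22 (q : ℕ) : substU q (d22 F q) = d22 F q := by simp [d22]

theorem exists_d22_pow_mul_eq_substU {q : ℕ} (f : R2 F) : ∃ n P, d22 F q ^ n * f = substU q P := by
  induction f using MvPolynomial.induction_on with
  | C r => exact ⟨0, C r, by simp [algHom_C]⟩
  | add f g hf hg =>
    obtain ⟨n, P, hP⟩ := hf
    obtain ⟨m, Q, hQ⟩ := hg
    refine ⟨n + m, d22 F q ^ m * P + d22 F q ^ n * Q, ?_⟩
    rw [map_add, map_mul, map_mul, map_pow, map_pow, substU_d22, ← hP, ← hQ]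
    ring
  | mul_X f i hf =>
    obtain ⟨n, P, hP⟩ := hf
    have key : ∃ Q, d22 F q * X i = substU q Q := by
      fin_cases i
      · exact ⟨d22 F q * X 0, by simp [substU_d22]⟩
      · exact ⟨d22 F q * X 1, by simp [substU_d22]⟩
      · exact ⟨X 1 * X 3 - X 1 ^ q * X 2, by simp [d22, u0, u1]; ring⟩
      · exact ⟨X 0 ^ q * X 2 - X 0 * X 3, by simp [d22, u0, u1]; ring⟩
    obtain ⟨Q, hQ⟩ := key
    refine ⟨n + 1, P * Q, ?_⟩
    rw [map_mul, ← hP, ← hQ]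
    ring

theorem swapXY_c21s {q : ℕ} {c21s : R2 F}
    (hc : d22s F q * c21s = X 2 * X 3 ^ (q ^ 2) - X 3 * X 2 ^ (q ^ 2)) :
    d22 F q * swapXY c21s = X 1 * X 0 ^ (q ^ 2) - X 0 * X 1 ^ (q ^ 2) := by
  have := congrArg swapXY hc
  simpa using this

variable [Fintype F] {q : ℕ}

theorem substU_injective (hF : Fintype.card F = q) :
    Function.Injective (substU q : R2 F →ₐ[F] R2 F) := by
  let L := FractionRing (R2 F)
  let ι : R2 F →ₐ[F] L := IsScalarTower.toAlgHom F (R2 F) L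
  have hι : Function.Injective ι := IsFractionRing.injective (R2 F) L
  have hd : ι (d22 F q) ≠ 0 := (map_ne_zero_iff ι hι).2 (d22_ne_zero hF)
  let ψ : R2 F →ₐ[F] L := aeval ![ι (X 0), ι (X 1),
    (ι (X 1) * ι (X 3) - ι (X 1) ^ q * ι (X 2)) / ι (d22 F q),
    (ι (X 0) ^ q * ι (X 2) - ι (X 0) * ι (X 3)) / ι (d22 F q)]
  have h0 : ψ (X 0) = ι (X 0) := by simp [ψ]
  have h1 : ψ (X 1) = ι (X 1) := by simp [ψ]
  have h2 : ψ (X 2) = (ι (X 1) * ι (X 3) - ι (X 1) ^ q * ι (X 2)) / ι (d22 F q) := by simp [ψ]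
  have h3 : ψ (X 3) = (ι (X 0) ^ q * ι (X 2) - ι (X 0) * ι (X 3)) / ι (d22 F q) := by simp [ψ]
  have hdι : ι (d22 F q) = ι (X 1) * ι (X 0) ^ q - ι (X 0) * ι (X 1) ^ q := by simp [d22]
  have key : ψ.comp (substU q) = ι := by
    apply algHom_ext
    intro i
    fin_cases i
    · simp [h0]
    · simp [h1]
    · simp only [Fin.reduceFinMk, AlgHom.comp_apply, substU_X2, u0, map_add, map_mul, h0, h1, h2,
        h3]
      rw [← mul_div_assoc, ← mul_div_assoc, ← add_div, div_eq_iff hd, hdι]; ring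
    · simp only [Fin.reduceFinMk, AlgHom.comp_apply, substU_X3, u1, map_add, map_mul, map_pow, h0,
        h1, h2, h3]
      rw [← mul_div_assoc, ← mul_div_assoc, ← add_div, div_eq_iff hd, hdι]; ring
  have : Function.Injective (ψ ∘ substU q) := by
    rw [← AlgHom.coe_comp, key]; exact hι
  exact this.of_comp

theorem actXY_substU (hF : Fintype.card F = q) {a b c d : F} (h : a * d - b * c = 1) (f : R2 F) :
    actXY a b c d (substU q f) = substU q (actX a b c d f) := by
  have : (actXY a b c d).comp (substU q) = (substU q).comp (actX a b c d) := by
    apply algHom_ext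
    intro i
    fin_cases i
    · simp [algHom_C]
    · simp [algHom_C]
    · simp [actXY_u0 h]
    · simp [actXY_u1 hF h]
  exact DFunLike.congr_fun this f

theorem exists_d22_pow_mul_mem (hF : Fintype.card F = q) {c21 : R2 F}
    (hc : d22 F q * c21 = X 1 * X 0 ^ (q ^ 2) - X 0 * X 1 ^ (q ^ 2)) {f : R2 F}
    (hf : f ∈ invariantRing (SL2 F)) :
    ∃ n, d22 F q ^ n * f ∈ Algebra.adjoin F {d22 F q, c21, u0 F, u1 F q} := by
  obtain ⟨n, P, hP⟩ := exists_d22_pow_mul_eq_substU (q := q) f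
  refine ⟨n, ?_⟩
  have hinv : ∀ a b c d : F, a * d - b * c = 1 → actX a b c d P = P := by
    intro a b c d h
    apply substU_injective hF
    rw [← actXY_substU hF h, ← hP, map_mul, map_pow, actXY_d22 hF h,
      mem_invariantRing_SL2_iff.1 hf a b c d h]
  have hmem := mem_adjoin_of_actX_eq hF hc P hinv
  have hc' : substU q c21 = c21 := by
    apply mul_left_cancel₀ (d22_ne_zero hF)
    have := congrArg (substU q) hc
    rw [map_mul, substU_d22] at this
    rw [this, hc]
    simp
  have h1 : substU q P ∈ (Algebra.adjoin F {d22 F q, c21, X 2, X 3}).map (substU q) :=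
    ⟨P, hmem, rfl⟩
  rw [hP]
  simpa [AlgHom.map_adjoin, Set.image_insert_eq, Set.image_singleton, substU_d22, hc'] using h1

theorem exists_d22s_pow_mul_mem (hF : Fintype.card F = q) {c21s : R2 F}
    (hc : d22s F q * c21s = X 2 * X 3 ^ (q ^ 2) - X 3 * X 2 ^ (q ^ 2)) {f : R2 F}
    (hf : f ∈ invariantRing (SL2 F)) :
    ∃ n, d22s F q ^ n * f ∈ Algebra.adjoin F {d22s F q, c21s, u0 F, u1s F q} := by
  obtain ⟨n, hn⟩ := exists_d22_pow_mul_mem hF (swapXY_c21s hc) (swapXY_mem_invariantRing hf)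
  refine ⟨n, ?_⟩
  have h1 : swapXY (d22 F q ^ n * swapXY f) ∈
      (Algebra.adjoin F {d22 F q, swapXY c21s, u0 F, u1 F q}).map swapXY := ⟨_, hn, rfl⟩
  simpa [AlgHom.map_adjoin, Set.image_insert_eq, Set.image_singleton, swapXY_swapXY] using h1

end localization

section relations
variable {F : Type} [Field F] [Fintype F] {q : ℕ}

theorem u0_pow_card (hF : Fintype.card F = q) :
    u0 F ^ q = X 0 ^ q * X 2 ^ q + X 1 ^ q * X 3 ^ q := by
  subst hF
  rw [u0, FiniteField.algebra_add_pow_card, mul_pow, mul_pow]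

theorem u0_pow_card_succ (hF : Fintype.card F = q) :
    u0 F ^ (q + 1) = u1 F q * u1s F q - d22 F q * d22s F q := by
  rw [pow_succ, u0_pow_card hF, u0, u1, u1s, d22, d22s]
  ring

theorem u1_pow_card (hF : Fintype.card F = q) {c21 : R2 F}
    (hc : d22 F q * c21 = X 1 * X 0 ^ (q ^ 2) - X 0 * X 1 ^ (q ^ 2)) :
    u1 F q ^ q = c21 * u0 F ^ q - d22 F q ^ (q - 1) * u1s F q := by
  have hq := one_lt_of_card hF
  apply mul_left_cancel₀ (d22_ne_zero hF)
  have e1 : u1 F q ^ q = X 0 ^ (q ^ 2) * X 2 ^ q + X 1 ^ (q ^ 2) * X 3 ^ q := by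
    subst hF
    rw [u1, FiniteField.algebra_add_pow_card, mul_pow, mul_pow, ← pow_mul, ← pow_mul, pow_two]
  have e2 : d22 F q * d22 F q ^ (q - 1) = X 1 ^ q * X 0 ^ (q ^ 2) - X 0 ^ q * X 1 ^ (q ^ 2) := by
    rw [← pow_succ', Nat.sub_add_cancel hq.le]
    subst hF
    rw [d22, FiniteField.algebra_sub_pow_card, mul_pow, mul_pow, ← pow_mul, ← pow_mul, pow_two]
  rw [e1, mul_sub, ← mul_assoc, ← mul_assoc, e2, hc, u0_pow_card hF, d22, u1s]
  ring

theorem u1s_pow_card (hF : Fintype.card F = q) {c21s : R2 F}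
    (hc : d22s F q * c21s = X 2 * X 3 ^ (q ^ 2) - X 3 * X 2 ^ (q ^ 2)) :
    u1s F q ^ q = c21s * u0 F ^ q - d22s F q ^ (q - 1) * u1 F q := by
  have := congrArg swapXY (u1_pow_card hF (swapXY_c21s hc))
  simpa [swapXY_swapXY] using this

variable {h : ℕ → R2 F}

theorem u1_mul_h (hF : Fintype.card F = q) (hh : ∀ s ≤ q - 1, u0 F ^ q * h s =
      u1 F q ^ (s + 1) * d22s F q ^ (q - s - 1) + u1s F q ^ (q - s) * d22 F q ^ s)
    {s : ℕ} (hs : s + 1 ≤ q - 1) :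
    u1 F q * h s = d22s F q * h (s + 1) + u0 F * u1s F q ^ (q - 1 - s) * d22 F q ^ s := by
  apply mul_left_cancel₀ (pow_ne_zero q (u0_ne_zero (F := F)))
  obtain ⟨r, hr⟩ : ∃ r, q = s + r + 2 := ⟨q - (s + 2), by omega⟩
  have h1 := hh s (by omega)
  have h2 := hh (s + 1) hs
  have h3 := u0_pow_card_succ hF
  rw [pow_succ] at h3
  have e1 : q - s - 1 = r + 1 := by omega
  have e2 : q - s = r + 2 := by omega
  have e3 : q - (s + 1) - 1 = r := by omega
  have e4 : q - (s + 1) = r + 1 := by omega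
  have e5 : q - 1 - s = r + 1 := by omega
  rw [e1, e2] at h1
  rw [e3, e4] at h2
  rw [e5]
  linear_combination u1 F q * h1 - d22s F q * h2 - u1s F q ^ (r + 1) * d22 F q ^ s * h3

theorem u1s_mul_h (hF : Fintype.card F = q) (hh : ∀ s ≤ q - 1, u0 F ^ q * h s =
      u1 F q ^ (s + 1) * d22s F q ^ (q - s - 1) + u1s F q ^ (q - s) * d22 F q ^ s)
    {s : ℕ} (hs : s + 1 ≤ q - 1) :
    u1s F q * h (s + 1) = d22 F q * h s + u0 F * u1 F q ^ (s + 1) * d22s F q ^ (q - 2 - s) := by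
  apply mul_left_cancel₀ (pow_ne_zero q (u0_ne_zero (F := F)))
  obtain ⟨r, hr⟩ : ∃ r, q = s + r + 2 := ⟨q - (s + 2), by omega⟩
  have h1 := hh s (by omega)
  have h2 := hh (s + 1) hs
  have h3 := u0_pow_card_succ hF
  rw [pow_succ] at h3
  have e1 : q - s - 1 = r + 1 := by omega
  have e2 : q - s = r + 2 := by omega
  have e3 : q - (s + 1) - 1 = r := by omega
  have e4 : q - (s + 1) = r + 1 := by omega
  have e5 : q - 2 - s = r := by omega
  rw [e1, e2] at h1
  rw [e3, e4] at h2
  rw [e5]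
  linear_combination u1s F q * h2 - d22 F q * h1 - u1 F q ^ (s + 1) * d22s F q ^ r * h3

theorem h_zero (hF : Fintype.card F = q) (hh : ∀ s ≤ q - 1, u0 F ^ q * h s =
      u1 F q ^ (s + 1) * d22s F q ^ (q - s - 1) + u1s F q ^ (q - s) * d22 F q ^ s)
    {c21s : R2 F}
    (hc : d22s F q * c21s = X 2 * X 3 ^ (q ^ 2) - X 3 * X 2 ^ (q ^ 2)) : h 0 = c21s := by
  apply mul_left_cancel₀ (pow_ne_zero q (u0_ne_zero (F := F)))
  rw [hh 0 (Nat.zero_le _), Nat.sub_zero, u1s_pow_card hF hc]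
  ring

theorem h_pred (hF : Fintype.card F = q) (hh : ∀ s ≤ q - 1, u0 F ^ q * h s =
      u1 F q ^ (s + 1) * d22s F q ^ (q - s - 1) + u1s F q ^ (q - s) * d22 F q ^ s)
    {c21 : R2 F}
    (hc : d22 F q * c21 = X 1 * X 0 ^ (q ^ 2) - X 0 * X 1 ^ (q ^ 2)) : h (q - 1) = c21 := by
  have hq := one_lt_of_card hF
  apply mul_left_cancel₀ (pow_ne_zero q (u0_ne_zero (F := F)))
  have e : q - (q - 1) = 1 := by omega
  rw [hh (q - 1) le_rfl, e, Nat.sub_add_cancel hq.le, u1_pow_card hF hc]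
  simp
  ring

theorem h_mem_invariantRing (hF : Fintype.card F = q) (hh : ∀ s ≤ q - 1, u0 F ^ q * h s =
      u1 F q ^ (s + 1) * d22s F q ^ (q - s - 1) + u1s F q ^ (q - s) * d22 F q ^ s)
    {s : ℕ} (hs : s ≤ q - 1) : h s ∈ invariantRing (SL2 F) := by
  rw [mem_invariantRing_SL2_iff]
  intro a b c d hdet
  apply mul_left_cancel₀ (pow_ne_zero q (u0_ne_zero (F := F)))
  have hmem : u0 F ^ q * h s ∈ invariantRing (SL2 F) := by
    rw [hh s hs]
    exact Subalgebra.add_mem _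
      (Subalgebra.mul_mem _ (Subalgebra.pow_mem _ (u1_mem hF) _)
        (Subalgebra.pow_mem _ (d22s_mem hF) _))
      (Subalgebra.mul_mem _ (Subalgebra.pow_mem _ (u1s_mem hF) _)
        (Subalgebra.pow_mem _ (d22_mem hF) _))
  have h1 := mem_invariantRing_SL2_iff.1 hmem a b c d hdet
  rwa [map_mul, map_pow, actXY_u0 hdet] at h1

end relations

section closure
variable {R : Type*} [CommRing R]

/-- An additive subgroup `M` stable under multiplication by `d`, `e`, `c`, `c'` and containing the
monomials `v ^ i * u ^ j`, `v ^ i * u ^ j * t ^ k` and `h s * t ^ k` in the ranges that occur in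
the basis of the vector and covector invariants of `SL₂`, where `t`, `u`, `v`, `d`, `e`, `c`, `c'`
satisfy the relations of that ring. -/
structure InvariantRelations (q : ℕ) (M : AddSubgroup R) (t u v d e c c' : R) (h : ℕ → R) :
    Prop where
  one_lt : 1 < q
  d_mul_mem : ∀ m ∈ M, d * m ∈ M
  e_mul_mem : ∀ m ∈ M, e * m ∈ M
  c_mul_mem : ∀ m ∈ M, c * m ∈ M
  c'_mul_mem : ∀ m ∈ M, c' * m ∈ M
  pow_mul_pow_mem : ∀ i j, i ≤ q - 1 → j ≤ q - 1 → v ^ i * u ^ j ∈ M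
  pow_mul_pow_mul_pow_mem : ∀ i j k, i ≤ q - 2 → j ≤ q - 2 → 1 ≤ k → k ≤ q →
    v ^ i * u ^ j * t ^ k ∈ M
  h_mul_pow_mem : ∀ s k, 1 ≤ s → s ≤ q - 2 → k ≤ q - 1 → h s * t ^ k ∈ M
  t_pow : t ^ (q + 1) = u * v - d * e
  u_pow : u ^ q = c * t ^ q - d ^ (q - 1) * v
  v_pow : v ^ q = c' * t ^ q - e ^ (q - 1) * u
  t_pow_mul_h : ∀ s ≤ q - 1, t ^ q * h s = u ^ (s + 1) * e ^ (q - s - 1) + v ^ (q - s) * d ^ s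
  u_mul_h : ∀ s, s + 1 ≤ q - 1 → u * h s = e * h (s + 1) + t * v ^ (q - 1 - s) * d ^ s
  v_mul_h : ∀ s, s + 1 ≤ q - 1 → v * h (s + 1) = d * h s + t * u ^ (s + 1) * e ^ (q - 2 - s)
  h_zero : h 0 = c'
  h_last : h (q - 1) = c

theorem pow_mul_mem_of_mul_mem {M : AddSubgroup R} {d : R} (hd : ∀ m ∈ M, d * m ∈ M) (n : ℕ)
    {m : R} (hm : m ∈ M) : d ^ n * m ∈ M := by
  induction n with
  | zero => simpa using hm
  | succ n ih => rw [pow_succ', mul_assoc]; exact hd _ ih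

namespace InvariantRelations
variable {q : ℕ} {M : AddSubgroup R} {t u v d e c c' : R} {h : ℕ → R}

theorem symm (H : InvariantRelations q M t u v d e c c' h) :
    InvariantRelations q M t v u e d c' c (fun s => h (q - 1 - s)) where
  one_lt := H.one_lt
  d_mul_mem := H.e_mul_mem
  e_mul_mem := H.d_mul_mem
  c_mul_mem := H.c'_mul_mem
  c'_mul_mem := H.c_mul_mem
  pow_mul_pow_mem i j hi hj := by rw [mul_comm]; exact H.pow_mul_pow_mem j i hj hi
  pow_mul_pow_mul_pow_mem i j k hi hj hk hk' := by
    rw [mul_comm (u ^ i)]; exact H.pow_mul_pow_mul_pow_mem j i k hj hi hk hk'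
  h_mul_pow_mem s k hs hs' hk := H.h_mul_pow_mem _ k (by omega) (by omega) hk
  t_pow := by rw [H.t_pow]; ring
  u_pow := H.v_pow
  v_pow := H.u_pow
  t_pow_mul_h s hs := by
    have := H.one_lt
    rw [H.t_pow_mul_h _ (Nat.sub_le _ _), add_comm, show q - (q - 1 - s) = s + 1 by omega,
      show q - 1 - s + 1 = q - s by omega, Nat.add_sub_cancel,
      show q - 1 - s = q - s - 1 by omega]
  u_mul_h s hs := by
    have := H.v_mul_h (q - 1 - (s + 1)) (by omega)
    rw [show q - 1 - (s + 1) + 1 = q - 1 - s by omega,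
      show q - 2 - (q - 1 - (s + 1)) = s by omega] at this
    exact this
  v_mul_h s hs := by
    have := H.u_mul_h (q - 1 - (s + 1)) (by omega)
    rw [show q - 1 - (s + 1) + 1 = q - 1 - s by omega,
      show q - 1 - (q - 1 - (s + 1)) = s + 1 by omega,
      show q - 1 - (s + 1) = q - 2 - s by omega] at this
    rw [show q - 1 - (s + 1) = q - 2 - s by omega]
    exact this
  h_zero := by simpa using H.h_last
  h_last := by simpa using H.h_zero

theorem u_pow_mul_h_mem (H : InvariantRelations q M t u v d e c c' h) {s j : ℕ} (hs : 1 ≤ s)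
    (hs' : s ≤ q - 1) (hj : j ≤ q - 1) : u ^ j * h s ∈ M := by
  induction j generalizing s with
  | zero =>
    rcases hs'.eq_or_lt with rfl | hlt
    · rw [H.h_last, mul_comm]
      exact H.c_mul_mem _ (by simpa using H.pow_mul_pow_mem 0 0 (by omega) (by omega))
    · simpa using H.h_mul_pow_mem s 0 hs (by omega) (by omega)
  | succ j ih =>
    rcases hs'.eq_or_lt with rfl | hlt
    · rw [H.h_last, mul_comm]
      exact H.c_mul_mem _ (by simpa using H.pow_mul_pow_mem 0 (j + 1) (by omega) hj)
    · rw [pow_succ, mul_assoc, H.u_mul_h s (by omega)]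
      have h1 := H.e_mul_mem _ (ih (s := s + 1) (by omega) (by omega) (by omega))
      have h2 := pow_mul_mem_of_mul_mem H.d_mul_mem s
        (H.pow_mul_pow_mul_pow_mem (q - 1 - s) j 1 (by omega) (by omega) le_rfl (by omega))
      convert M.add_mem h1 h2 using 1
      ring

theorem u_pow_mem (H : InvariantRelations q M t u v d e c c' h) : u ^ q ∈ M := by
  have := H.one_lt
  rw [H.u_pow]
  refine M.sub_mem (H.c_mul_mem _ ?_) (pow_mul_mem_of_mul_mem H.d_mul_mem _ ?_)
  · simpa using H.pow_mul_pow_mul_pow_mem 0 0 q (by omega) (by omega) (by omega) le_rfl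
  · simpa using H.pow_mul_pow_mem 1 0 (by omega) (by omega)

theorem t_mul_v_pow_pred_mul_mem (H : InvariantRelations q M t u v d e c c' h) {j : ℕ}
    (hj : j ≤ q - 1) : t * (v ^ (q - 1) * u ^ j) ∈ M := by
  have hq := H.one_lt
  have h1 : u ^ (j + 1) ∈ M := by
    rcases hj.eq_or_lt with rfl | hlt
    · rw [Nat.sub_add_cancel hq.le]; exact H.u_pow_mem
    · simpa using H.pow_mul_pow_mem 0 (j + 1) (by omega) (by omega)
  have h2 := H.u_mul_h 0 (by omega)
  rw [H.h_zero, Nat.sub_zero, zero_add] at h2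
  convert M.sub_mem (H.c'_mul_mem _ h1)
    (H.e_mul_mem _ (H.u_pow_mul_h_mem le_rfl (by omega) hj)) using 1
  linear_combination -u ^ j * h2

theorem t_mul_pow_mul_pow_mem (H : InvariantRelations q M t u v d e c c' h) {i j : ℕ}
    (hi : i ≤ q - 1) (hj : j ≤ q - 1) : t * (v ^ i * u ^ j) ∈ M := by
  have hq := H.one_lt
  rcases hi.eq_or_lt with rfl | hi'
  · exact H.t_mul_v_pow_pred_mul_mem hj
  rcases hj.eq_or_lt with rfl | hj'
  · rw [mul_comm (v ^ i)]
    exact H.symm.t_mul_v_pow_pred_mul_mem hi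
  · simpa [mul_comm t] using
      H.pow_mul_pow_mul_pow_mem i j 1 (by omega) (by omega) le_rfl (by omega)

theorem t_mul_pow_mul_pow_mul_pow_mem (H : InvariantRelations q M t u v d e c c' h) {i j k : ℕ}
    (hi : i ≤ q - 2) (hj : j ≤ q - 2) (hk : k ≤ q) : t * (v ^ i * u ^ j * t ^ k) ∈ M := by
  have hq := H.one_lt
  rcases hk.eq_or_lt with rfl | hk'
  · convert M.sub_mem (H.pow_mul_pow_mem (i + 1) (j + 1) (by omega) (by omega))
      (H.d_mul_mem _ (H.e_mul_mem _ (H.pow_mul_pow_mem i j (by omega) (by omega)))) using 1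
    linear_combination v ^ i * u ^ j * H.t_pow
  · convert H.pow_mul_pow_mul_pow_mem i j (k + 1) hi hj (by omega) (by omega) using 1
    ring

theorem t_mul_h_mul_pow_mem (H : InvariantRelations q M t u v d e c c' h) {s k : ℕ}
    (hs : 1 ≤ s) (hs' : s ≤ q - 2) (hk : k ≤ q - 1) : t * (h s * t ^ k) ∈ M := by
  have hq := H.one_lt
  rcases hk.eq_or_lt with rfl | hk'
  · have h1 := pow_mul_mem_of_mul_mem H.e_mul_mem (q - s - 1)
      (H.pow_mul_pow_mem 0 (s + 1) (by omega) (by omega))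
    have h2 := pow_mul_mem_of_mul_mem H.d_mul_mem s
      (H.pow_mul_pow_mem (q - s) 0 (by omega) (by omega))
    rw [show t * (h s * t ^ (q - 1)) = t ^ (q - 1 + 1) * h s by ring, Nat.sub_add_cancel hq.le,
      H.t_pow_mul_h s (by omega)]
    convert M.add_mem h1 h2 using 1
    ring
  · convert H.h_mul_pow_mem s (k + 1) hs hs' (by omega) using 1
    ring

theorem u_mul_pow_mul_pow_mem (H : InvariantRelations q M t u v d e c c' h)
    (ht : ∀ m ∈ M, t * m ∈ M) {i j : ℕ} (hi : i ≤ q - 1) (hj : j ≤ q - 1) :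
    u * (v ^ i * u ^ j) ∈ M := by
  have hq := H.one_lt
  rcases hj.eq_or_lt with rfl | hj'
  · have h1 : v ^ (i + 1) ∈ M := by
      rcases hi.eq_or_lt with rfl | hi'
      · rw [Nat.sub_add_cancel hq.le]; exact H.symm.u_pow_mem
      · simpa using H.pow_mul_pow_mem (i + 1) 0 (by omega) (by omega)
    have h2 := H.c_mul_mem _ (pow_mul_mem_of_mul_mem ht q
      (H.pow_mul_pow_mem i 0 hi (by omega)))
    rw [show u * (v ^ i * u ^ (q - 1)) = v ^ i * u ^ (q - 1 + 1) by ring,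
      Nat.sub_add_cancel hq.le, H.u_pow]
    convert M.sub_mem h2 (pow_mul_mem_of_mul_mem H.d_mul_mem (q - 1) h1) using 1
    ring
  · convert H.pow_mul_pow_mem i (j + 1) hi (by omega) using 1
    ring

theorem u_mul_pow_mul_pow_mul_pow_mem (H : InvariantRelations q M t u v d e c c' h)
    (ht : ∀ m ∈ M, t * m ∈ M) {i j k : ℕ} (hi : i ≤ q - 2) (hj : j ≤ q - 2) :
    u * (v ^ i * u ^ j * t ^ k) ∈ M := by
  have hq := H.one_lt
  convert pow_mul_mem_of_mul_mem ht k
    (H.pow_mul_pow_mem i (j + 1) (by omega) (by omega)) using 1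
  ring

theorem u_mul_h_mul_pow_mem (H : InvariantRelations q M t u v d e c c' h)
    (ht : ∀ m ∈ M, t * m ∈ M) {s k : ℕ} (hs : 1 ≤ s) (hs' : s ≤ q - 2) :
    u * (h s * t ^ k) ∈ M := by
  have hq := H.one_lt
  convert pow_mul_mem_of_mul_mem ht k
    (H.u_pow_mul_h_mem (s := s) (j := 1) hs (by omega) (by omega)) using 1
  ring

end InvariantRelations
end closure

section stabilizer
variable {K R : Type*} [CommRing K] [CommRing R] [Algebra K R] {A : Subalgebra K R}

/-- The elements of an algebra which map a given submodule into itself. -/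
def Submodule.mulStabilizer (M : Submodule A R) : Subalgebra K R where
  carrier := {r | ∀ m ∈ M, r * m ∈ M}
  mul_mem' hr hs m hm := by rw [mul_assoc]; exact hr _ (hs m hm)
  add_mem' hr hs m hm := by rw [add_mul]; exact M.add_mem (hr m hm) (hs m hm)
  algebraMap_mem' k m hm := M.smul_mem (algebraMap K A k) hm

theorem Submodule.le_mulStabilizer (M : Submodule A R) : A ≤ M.mulStabilizer :=
  fun r hr _ hm => M.smul_mem (⟨r, hr⟩ : A) hm

theorem Submodule.mem_mulStabilizer_span {S : Set R} {r : R}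
    (hr : ∀ s ∈ S, r * s ∈ Submodule.span A S) : r ∈ (Submodule.span A S).mulStabilizer := by
  intro m hm
  induction hm using Submodule.span_induction with
  | mem s hs => exact hr s hs
  | zero => simp
  | add x y _ _ hx hy => rw [mul_add]; exact Submodule.add_mem _ hx hy
  | smul a x _ hx => rw [mul_smul_comm]; exact Submodule.smul_mem _ _ hx

end stabilizer

section spanning
variable {F : Type} [Field F]

/-- The proposed basis of the ring of invariants of `SL₂` over the subalgebra generated by the
Dickson invariants. -/
def invariantBasis (q : ℕ) (h : ℕ → R2 F) : Set (R2 F) :=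
  {f | ∃ i j, i ≤ q - 1 ∧ j ≤ q - 1 ∧ f = u1s F q ^ i * u1 F q ^ j} ∪
  {f | ∃ i j k, i ≤ q - 2 ∧ j ≤ q - 2 ∧ 1 ≤ k ∧ k ≤ q ∧
    f = u1s F q ^ i * u1 F q ^ j * u0 F ^ k} ∪
  {f | ∃ s k, 1 ≤ s ∧ s ≤ q - 2 ∧ k ≤ q - 1 ∧ f = h s * u0 F ^ k}

theorem one_mem_invariantBasis (q : ℕ) (h : ℕ → R2 F) : (1 : R2 F) ∈ invariantBasis q h :=
  .inl (.inl ⟨0, 0, Nat.zero_le _, Nat.zero_le _, by simp⟩)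

theorem mulStabilizer_span_le {q : ℕ} {c21 c21s : R2 F} {h : ℕ → R2 F} :
    ((Submodule.span (Algebra.adjoin F {d22 F q, c21, d22s F q, c21s})
      (invariantBasis q h)).mulStabilizer : Set (R2 F)) ⊆
      (Submodule.span (Algebra.adjoin F {d22 F q, c21, d22s F q, c21s}) (invariantBasis q h)) :=
  fun r hr => by simpa using hr 1 (Submodule.subset_span (one_mem_invariantBasis q h))

variable [Fintype F] {q : ℕ} {c21 c21s : R2 F} {h : ℕ → R2 F}

theorem invariantBasis_subset (hF : Fintype.card F = q)
    (hh : ∀ s ≤ q - 1, u0 F ^ q * h s =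
      u1 F q ^ (s + 1) * d22s F q ^ (q - s - 1) + u1s F q ^ (q - s) * d22 F q ^ s) :
    invariantBasis q h ⊆ (invariantRing (SL2 F) : Set (R2 F)) := by
  rintro f ((⟨i, j, -, -, rfl⟩ | ⟨i, j, k, -, -, -, -, rfl⟩) | ⟨s, k, -, hs, -, rfl⟩)
  · exact mul_mem (pow_mem (u1s_mem hF) _) (pow_mem (u1_mem hF) _)
  · exact mul_mem (mul_mem (pow_mem (u1s_mem hF) _) (pow_mem (u1_mem hF) _)) (pow_mem u0_mem _)
  · exact mul_mem (h_mem_invariantRing hF hh (by omega)) (pow_mem u0_mem _)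

theorem invariantRelations_span (hF : Fintype.card F = q)
    (hc : d22 F q * c21 = X 1 * X 0 ^ (q ^ 2) - X 0 * X 1 ^ (q ^ 2))
    (hcs : d22s F q * c21s = X 2 * X 3 ^ (q ^ 2) - X 3 * X 2 ^ (q ^ 2))
    (hh : ∀ s ≤ q - 1, u0 F ^ q * h s =
      u1 F q ^ (s + 1) * d22s F q ^ (q - s - 1) + u1s F q ^ (q - s) * d22 F q ^ s) :
    InvariantRelations q (Submodule.span (Algebra.adjoin F {d22 F q, c21, d22s F q, c21s})
      (invariantBasis q h)).toAddSubgroup (u0 F) (u1 F q) (u1s F q) (d22 F q) (d22s F q)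
      c21 c21s h where
  one_lt := one_lt_of_card hF
  d_mul_mem := Submodule.le_mulStabilizer _ (Algebra.subset_adjoin (by simp))
  e_mul_mem := Submodule.le_mulStabilizer _ (Algebra.subset_adjoin (by simp))
  c_mul_mem := Submodule.le_mulStabilizer _ (Algebra.subset_adjoin (by simp))
  c'_mul_mem := Submodule.le_mulStabilizer _ (Algebra.subset_adjoin (by simp))
  pow_mul_pow_mem i j hi hj := Submodule.subset_span (.inl (.inl ⟨i, j, hi, hj, rfl⟩))
  pow_mul_pow_mul_pow_mem i j k hi hj hk hk' :=
    Submodule.subset_span (.inl (.inr ⟨i, j, k, hi, hj, hk, hk', rfl⟩))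
  h_mul_pow_mem s k hs hs' hk := Submodule.subset_span (.inr ⟨s, k, hs, hs', hk, rfl⟩)
  t_pow := u0_pow_card_succ hF
  u_pow := u1_pow_card hF hc
  v_pow := u1s_pow_card hF hcs
  t_pow_mul_h := hh
  u_mul_h _ hs := u1_mul_h hF hh hs
  v_mul_h _ hs := u1s_mul_h hF hh hs
  h_zero := h_zero hF hh hcs
  h_last := h_pred hF hh hc

theorem u0_u1_u1s_mem_mulStabilizer (hF : Fintype.card F = q)
    (hc : d22 F q * c21 = X 1 * X 0 ^ (q ^ 2) - X 0 * X 1 ^ (q ^ 2))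
    (hcs : d22s F q * c21s = X 2 * X 3 ^ (q ^ 2) - X 3 * X 2 ^ (q ^ 2))
    (hh : ∀ s ≤ q - 1, u0 F ^ q * h s =
      u1 F q ^ (s + 1) * d22s F q ^ (q - s - 1) + u1s F q ^ (q - s) * d22 F q ^ s) :
    {u0 F, u1 F q, u1s F q} ⊆
      ((Submodule.span (Algebra.adjoin F {d22 F q, c21, d22s F q, c21s})
        (invariantBasis q h)).mulStabilizer : Set (R2 F)) := by
  have H := invariantRelations_span hF hc hcs hh
  have h0 : u0 F ∈ (Submodule.span (Algebra.adjoin F {d22 F q, c21, d22s F q, c21s})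
      (invariantBasis q h)).mulStabilizer := by
    apply Submodule.mem_mulStabilizer_span
    rintro f ((⟨i, j, hi, hj, rfl⟩ | ⟨i, j, k, hi, hj, hk, hk', rfl⟩) | ⟨s, k, hs, hs', hk, rfl⟩)
    · exact H.t_mul_pow_mul_pow_mem hi hj
    · exact H.t_mul_pow_mul_pow_mul_pow_mem hi hj hk'
    · exact H.t_mul_h_mul_pow_mem hs hs' hk
  rintro _ (rfl | rfl | rfl)
  · exact h0
  · apply Submodule.mem_mulStabilizer_span
    rintro f ((⟨i, j, hi, hj, rfl⟩ | ⟨i, j, k, hi, hj, hk, hk', rfl⟩) | ⟨s, k, hs, hs', hk, rfl⟩)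
    · exact H.u_mul_pow_mul_pow_mem h0 hi hj
    · exact H.u_mul_pow_mul_pow_mul_pow_mem h0 hi hj
    · exact H.u_mul_h_mul_pow_mem h0 hs hs'
  · apply Submodule.mem_mulStabilizer_span
    rintro f ((⟨i, j, hi, hj, rfl⟩ | ⟨i, j, k, hi, hj, hk, hk', rfl⟩) | ⟨s, k, hs, hs', hk, rfl⟩)
    · rw [mul_comm (u1s F q ^ i)]
      exact H.symm.u_mul_pow_mul_pow_mem h0 hj hi
    · rw [mul_comm (u1s F q ^ i)]
      exact H.symm.u_mul_pow_mul_pow_mul_pow_mem h0 hj hi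
    · have := H.symm.u_mul_h_mul_pow_mem h0 (s := q - 1 - s) (k := k) (by omega) (by omega)
      rwa [Nat.sub_sub_self (by omega)] at this

theorem exists_d22_pow_mul_mem_span (hF : Fintype.card F = q)
    (hc : d22 F q * c21 = X 1 * X 0 ^ (q ^ 2) - X 0 * X 1 ^ (q ^ 2))
    (hcs : d22s F q * c21s = X 2 * X 3 ^ (q ^ 2) - X 3 * X 2 ^ (q ^ 2))
    (hh : ∀ s ≤ q - 1, u0 F ^ q * h s =
      u1 F q ^ (s + 1) * d22s F q ^ (q - s - 1) + u1s F q ^ (q - s) * d22 F q ^ s)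
    {f : R2 F} (hf : f ∈ invariantRing (SL2 F)) :
    ∃ n, d22 F q ^ n * f ∈ Submodule.span
      (Algebra.adjoin F {d22 F q, c21, d22s F q, c21s}) (invariantBasis q h) := by
  obtain ⟨n, hn⟩ := exists_d22_pow_mul_mem hF hc hf
  refine ⟨n, mulStabilizer_span_le (Algebra.adjoin_le ?_ hn)⟩
  have h1 := u0_u1_u1s_mem_mulStabilizer hF hc hcs hh
  rintro _ (rfl | rfl | rfl | rfl)
  · exact Submodule.le_mulStabilizer _ (Algebra.subset_adjoin (by simp))
  · exact Submodule.le_mulStabilizer _ (Algebra.subset_adjoin (by simp))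
  · exact h1 (by simp)
  · exact h1 (by simp)

theorem exists_d22s_pow_mul_mem_span (hF : Fintype.card F = q)
    (hc : d22 F q * c21 = X 1 * X 0 ^ (q ^ 2) - X 0 * X 1 ^ (q ^ 2))
    (hcs : d22s F q * c21s = X 2 * X 3 ^ (q ^ 2) - X 3 * X 2 ^ (q ^ 2))
    (hh : ∀ s ≤ q - 1, u0 F ^ q * h s =
      u1 F q ^ (s + 1) * d22s F q ^ (q - s - 1) + u1s F q ^ (q - s) * d22 F q ^ s)
    {f : R2 F} (hf : f ∈ invariantRing (SL2 F)) :
    ∃ n, d22s F q ^ n * f ∈ Submodule.span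
      (Algebra.adjoin F {d22 F q, c21, d22s F q, c21s}) (invariantBasis q h) := by
  obtain ⟨n, hn⟩ := exists_d22s_pow_mul_mem hF hcs hf
  refine ⟨n, mulStabilizer_span_le (Algebra.adjoin_le ?_ hn)⟩
  have h1 := u0_u1_u1s_mem_mulStabilizer hF hc hcs hh
  rintro _ (rfl | rfl | rfl | rfl)
  · exact Submodule.le_mulStabilizer _ (Algebra.subset_adjoin (by simp))
  · exact Submodule.le_mulStabilizer _ (Algebra.subset_adjoin (by simp))
  · exact h1 (by simp)
  · exact h1 (by simp)

end spanning

section independence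

theorem isIntegral_of_pow_sq_eq {K R : Type*} [CommRing K] [CommRing R] [Algebra K R]
    {A : Subalgebra K R} {q : ℕ} (hq : 1 < q) {x c d : R} (hc : c ∈ A) (hd : d ∈ A)
    (hx : x ^ (q ^ 2) = c * x ^ q - d * x) : IsIntegral A x := by
  have hq2 : q + 1 ≤ q ^ 2 := by nlinarith
  refine ⟨Polynomial.X ^ (q ^ 2) - (Polynomial.C ⟨c, hc⟩ * Polynomial.X ^ q -
    Polynomial.C ⟨d, hd⟩ * Polynomial.X), ?_, by simp [hx]⟩
  apply Polynomial.monic_X_pow_sub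
  refine (Polynomial.degree_sub_le _ _).trans_lt (max_lt ?_ ?_)
  · exact (Polynomial.degree_C_mul_X_pow_le _ _).trans_lt (by exact_mod_cast hq2)
  · exact (Polynomial.degree_C_mul_X_le _).trans_lt (by exact_mod_cast hq.trans hq2)

variable {F : Type} [Field F] [Fintype F] {q : ℕ} {c21 c21s : R2 F}

theorem X_pow_card_sq (hF : Fintype.card F = q)
    (hc : d22 F q * c21 = X 1 * X 0 ^ (q ^ 2) - X 0 * X 1 ^ (q ^ 2)) {i : Fin 4}
    (hi : i = 0 ∨ i = 1) :
    (X i : R2 F) ^ (q ^ 2) = c21 * X i ^ q - d22 F q ^ (q - 1) * X i := by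
  have hq := one_lt_of_card hF
  apply mul_left_cancel₀ (d22_ne_zero hF)
  have e2 : d22 F q * d22 F q ^ (q - 1) = X 1 ^ q * X 0 ^ (q ^ 2) - X 0 ^ q * X 1 ^ (q ^ 2) := by
    rw [← pow_succ', Nat.sub_add_cancel hq.le]
    subst hF
    rw [d22, FiniteField.algebra_sub_pow_card, mul_pow, mul_pow, ← pow_mul, ← pow_mul, pow_two]
  rcases hi with rfl | rfl <;> rw [mul_sub, ← mul_assoc, ← mul_assoc, e2, hc, d22] <;> ring

theorem X_pow_card_sq_star (hF : Fintype.card F = q)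
    (hc : d22s F q * c21s = X 2 * X 3 ^ (q ^ 2) - X 3 * X 2 ^ (q ^ 2)) {i : Fin 4}
    (hi : i = 2 ∨ i = 3) :
    (X i : R2 F) ^ (q ^ 2) = c21s * X i ^ q - d22s F q ^ (q - 1) * X i := by
  have hi' : i.rev = 0 ∨ i.rev = 1 := by rcases hi with rfl | rfl <;> decide
  have := congrArg swapXY (X_pow_card_sq hF (swapXY_c21s hc) hi')
  have hX : swapXY (X i.rev : R2 F) = X i := by simp [swapXY]
  simpa [swapXY_swapXY, hX] using this

theorem algebraicIndependent_dickson (hF : Fintype.card F = q)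
    (hc : d22 F q * c21 = X 1 * X 0 ^ (q ^ 2) - X 0 * X 1 ^ (q ^ 2))
    (hcs : d22s F q * c21s = X 2 * X 3 ^ (q ^ 2) - X 3 * X 2 ^ (q ^ 2)) :
    AlgebraicIndependent F ![d22 F q, c21, d22s F q, c21s] := by
  have hq := one_lt_of_card hF
  let A := Algebra.adjoin F (Set.range ![d22 F q, c21, d22s F q, c21s])
  have hA : ∀ i, ![d22 F q, c21, d22s F q, c21s] i ∈ A :=
    fun i => Algebra.subset_adjoin ⟨i, rfl⟩
  have hX : ∀ i, IsIntegral A (X i : R2 F) := by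
    intro i
    have h01 : i = 0 ∨ i = 1 → IsIntegral A (X i : R2 F) := fun hi =>
      isIntegral_of_pow_sq_eq hq (hA 1) (pow_mem (hA 0) (q - 1))
        (X_pow_card_sq hF hc hi)
    have h23 : i = 2 ∨ i = 3 → IsIntegral A (X i : R2 F) := fun hi =>
      isIntegral_of_pow_sq_eq hq (hA 3) (pow_mem (hA 2) (q - 1))
        (X_pow_card_sq_star hF hcs hi)
    have hi :=
      (by decide : ∀ i : Fin 4, (i = 0 ∨ i = 1) ∨ (i = 2 ∨ i = 3)) i
    exact hi.elim h01 h23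
  have hint : Algebra.IsIntegral A (R2 F) := by
    refine ⟨fun f => ?_⟩
    induction f using MvPolynomial.induction_on with
    | C r => exact isIntegral_algebraMap (x := algebraMap F A r)
    | add f g hf hg => exact hf.add hg
    | mul_X f i hf => exact hf.mul (hX i)
  have : Algebra.IsAlgebraic A (R2 F) := Algebra.IsIntegral.isAlgebraic
  exact (Algebra.IsAlgebraic.isTranscendenceBasis_of_le_trdeg_of_finite F
    ![d22 F q, c21, d22s F q, c21s] (by simp)).1

theorem exists_eq_d22_pow_mul (hF : Fintype.card F = q)
    (hc : d22 F q * c21 = X 1 * X 0 ^ (q ^ 2) - X 0 * X 1 ^ (q ^ 2))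
    (hcs : d22s F q * c21s = X 2 * X 3 ^ (q ^ 2) - X 3 * X 2 ^ (q ^ 2)) {a b : R2 F}
    (ha : a ∈ Algebra.adjoin F {d22 F q, c21, d22s F q, c21s})
    (hb : b ∈ Algebra.adjoin F {d22 F q, c21, d22s F q, c21s}) {m n : ℕ}
    (hab : d22s F q ^ m * a = d22 F q ^ n * b) :
    ∃ a' ∈ Algebra.adjoin F {d22 F q, c21, d22s F q, c21s}, a = d22 F q ^ n * a' := by
  have hi := algebraicIndependent_dickson hF hc hcs
  have hr : Algebra.adjoin F {d22 F q, c21, d22s F q, c21s} =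
      (aeval (R := F) ![d22 F q, c21, d22s F q, c21s]).range := by
    rw [← Algebra.adjoin_range_eq_range_aeval]
    congr 1
    ext x
    simp [eq_comm]
    tauto
  rw [hr] at ha hb ⊢
  obtain ⟨P, rfl⟩ := ha
  obtain ⟨Q, rfl⟩ := hb
  have hPQ : (X 2 : R2 F) ^ m * P = X 0 ^ n * Q := by
    apply hi
    simpa using hab
  obtain ⟨P', rfl⟩ : (X 0 : R2 F) ^ n ∣ P :=
    X_prime.pow_dvd_of_dvd_mul_left _
      (fun h => by simpa [X_dvd_X] using X_prime.dvd_of_dvd_pow h) ⟨Q, hPQ⟩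
  exact ⟨aeval _ P', ⟨P', rfl⟩, by simp⟩

end independence

section linear_independence

theorem linearIndependent_of_forall_mulStabilizer {K R G : Type*} [CommRing K] [CommRing R]
    [IsDomain R] [Algebra K R] [Fintype G] {A : Subalgebra K R} {S : Set R} [Finite S]
    (h1 : 1 ∈ Submodule.span A S) (σ : G → R →ₐ[K] R) (hA : ∀ g, ∀ a ∈ A, σ g a = a)
    (hσ : ∀ g g', (∀ r ∈ (Submodule.span A S).mulStabilizer, σ g r = σ g' r) → g = g')
    (hcard : Nat.card S ≤ Fintype.card G) : LinearIndependent A ((↑) : S → R) := by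
  classical
  have := Fintype.ofFinite S
  let L := FractionRing R
  have hL : Function.Injective (algebraMap R L) := IsFractionRing.injective R L
  let v : S → G → L := fun s g => algebraMap R L (σ g s)
  let P := (Submodule.span A S).mulStabilizer
  let χ : G → P →* L := fun g =>
    ((algebraMap R L).comp ((σ g).toRingHom.comp P.toSubring.subtype) : P →+* L)
  have hχ : Function.Injective χ := by
    intro g g' h
    refine hσ g g' fun r hr => hL ?_
    exact DFunLike.congr_fun h (⟨r, hr⟩ : P)
  have hindep : LinearIndependent L (fun g => (χ g : P → L)) :=
    (linearIndependent_monoidHom P L).comp χ hχ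
  have hspan : ⊤ ≤ Submodule.span L (Set.range v) := by
    by_contra hne
    obtain ⟨f, hf0, hf⟩ := Submodule.exists_le_ker_of_lt_top _ (lt_top_iff_ne_top.2
      fun h => hne h.ge)
    have hfw : ∀ w : G → L, f w = ∑ g, f (Pi.single g 1) * w g := by
      intro w
      rw [f.pi_apply_eq_sum_univ w]
      refine Finset.sum_congr rfl fun g _ => ?_
      rw [smul_eq_mul, mul_comm]
      congr 2
      ext
      simp [Pi.single_apply, eq_comm]
    have hM : ∀ m ∈ Submodule.span A S,
        ∑ g, f (Pi.single g 1) * algebraMap R L (σ g m) = 0 := by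
      intro m hm
      induction hm using Submodule.span_induction with
      | mem s hs =>
        rw [← hfw fun g => algebraMap R L (σ g s)]
        exact hf (Submodule.subset_span ⟨⟨s, hs⟩, rfl⟩)
      | zero => simp
      | add x y _ _ hx hy => simp [mul_add, Finset.sum_add_distrib, hx, hy]
      | smul a x _ hx =>
        have : ∀ g, σ g (a • x) = a * σ g x := fun g => by
          rw [Subalgebra.smul_def, smul_eq_mul, map_mul, hA g _ a.2]
        simp only [this, map_mul, mul_left_comm _ (algebraMap R L a)]
        rw [← Finset.mul_sum, hx, mul_zero]
    have hzero := Fintype.linearIndependent_iff.1 hindep (fun g => f (Pi.single g 1)) (by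
      ext r
      have := hM r (by simpa using r.2 1 h1)
      simpa [χ] using this)
    exact hf0 (LinearMap.ext fun w => by simp [hfw w, hzero])
  have hcard' : Fintype.card S = Module.finrank L (G → L) := by
    rw [Module.finrank_fintype_fun_eq_card]
    refine le_antisymm (by rwa [← Nat.card_eq_fintype_card]) ?_
    have := finrank_range_le_card (R := L) v
    rwa [Set.finrank, top_le_iff.1 hspan, finrank_top, Module.finrank_fintype_fun_eq_card] at this
  have hv := linearIndependent_of_top_le_span_of_card_eq_finrank hspan hcard'
  rw [Fintype.linearIndependent_iff] at hv ⊢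
  intro a ha s
  have := hv (fun s => algebraMap R L (a s)) (by
    ext g
    have h2 := congrArg (fun x => algebraMap R L (σ g x)) ha
    simpa [Subalgebra.smul_def, hA g _ (a _).2, v, Algebra.smul_def] using h2) s
  exact Subtype.ext (hL (by simpa using this))

end linear_independence

section basis
variable {F : Type} [Field F]

theorem actX_d22s (a b c d : F) (q : ℕ) : actX a b c d (d22s F q) = d22s F q := by simp [d22s]

theorem eq_of_actX_u0_eq {a b c d a' b' c' d' : F}
    (h : actX a b c d (u0 F) = actX a' b' c' d' (u0 F)) :
    (a, b, c, d) = (a', b', c', d') := by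
  have key : ∀ x : Fin 4 → F, (d * x 0 - c * x 1) * x 2 + (a * x 1 - b * x 0) * x 3 =
      (d' * x 0 - c' * x 1) * x 2 + (a' * x 1 - b' * x 0) * x 3 := fun x => by
    simpa [u0] using congrArg (eval x) h
  have h1 := key ![1, 0, 1, 0]
  have h2 := key ![0, 1, 1, 0]
  have h3 := key ![1, 0, 0, 1]
  have h4 := key ![0, 1, 0, 1]
  simp at h1 h2 h3 h4
  simp [h1, h2, h3, h4]

theorem le_card_det_eq_one [Fintype F] [DecidableEq F] {q : ℕ} (hF : Fintype.card F = q) :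
    (q - 1) * (q * q) + (q - 1) * q ≤
      Fintype.card {p : F × F × F × F // p.1 * p.2.2.2 - p.2.1 * p.2.2.1 = 1} := by
  let φ : (Fˣ × F × F) ⊕ (Fˣ × F) → {p : F × F × F × F // p.1 * p.2.2.2 - p.2.1 * p.2.2.1 = 1} :=
    Sum.elim (fun x => ⟨(x.1, x.2.1, x.2.2, (1 + x.2.1 * x.2.2) / x.1), by
        rw [mul_div_cancel₀ _ x.1.ne_zero]; ring⟩)
      (fun x => ⟨(0, x.1, -(x.1 : F)⁻¹, x.2), by simp⟩)
  have hφ : Function.Injective φ := by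
    rintro (⟨a, b, c⟩ | ⟨b, d⟩) (⟨a', b', c'⟩ | ⟨b', d'⟩) h <;>
      simp only [φ, Sum.elim_inl, Sum.elim_inr, Subtype.mk.injEq, Prod.mk.injEq, Units.val_inj] at h
    · simp [h.1, h.2.1, h.2.2.1]
    · exact absurd h.1 a.ne_zero
    · exact absurd h.1.symm a'.ne_zero
    · simp [h.2.1, h.2.2.2]
  simpa [Fintype.card_units, hF] using Fintype.card_le_of_injective φ hφ

theorem finite_invariantBasis_and_card_le {q : ℕ} (hq : 1 < q) (h : ℕ → R2 F) :
    (invariantBasis q h).Finite ∧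
      Nat.card (invariantBasis q h) ≤ (q - 1) * (q * q) + (q - 1) * q := by
  classical
  let T : Finset (R2 F) :=
    (Finset.range q ×ˢ Finset.range q).image (fun p => u1s F q ^ p.1 * u1 F q ^ p.2) ∪
    (Finset.range (q - 1) ×ˢ Finset.range (q - 1) ×ˢ Finset.Icc 1 q).image
      (fun p => u1s F q ^ p.1 * u1 F q ^ p.2.1 * u0 F ^ p.2.2) ∪
    (Finset.Icc 1 (q - 2) ×ˢ Finset.range q).image (fun p => h p.1 * u0 F ^ p.2)
  have hT : invariantBasis q h ⊆ T := by
    rintro f ((⟨i, j, hi, hj, rfl⟩ | ⟨i, j, k, hi, hj, hk, hk', rfl⟩) | ⟨s, k, hs, hs', hk, rfl⟩)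
    · refine Finset.mem_union_left _ (Finset.mem_union_left _
        (Finset.mem_image.2 ⟨(i, j), ?_, rfl⟩))
      simp; omega
    · refine Finset.mem_union_left _ (Finset.mem_union_right _
        (Finset.mem_image.2 ⟨(i, j, k), ?_, rfl⟩))
      simp; omega
    · refine Finset.mem_union_right _ (Finset.mem_image.2 ⟨(s, k), ?_, rfl⟩)
      simp; omega
  refine ⟨T.finite_toSet.subset hT, ?_⟩
  have hcard : T.card ≤ q * q + (q - 1) * ((q - 1) * q) + (q - 2) * q := by
    refine (Finset.card_union_le _ _).trans (Nat.add_le_add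
      ((Finset.card_union_le _ _).trans (Nat.add_le_add ?_ ?_)) ?_) <;>
    exact Finset.card_image_le.trans (by simp)
  calc Nat.card (invariantBasis q h) = (invariantBasis q h).ncard := Nat.card_coe_set_eq _
    _ ≤ (T : Set (R2 F)).ncard := Set.ncard_le_ncard hT
    _ = T.card := Set.ncard_coe_finset T
    _ ≤ _ := hcard
    _ = _ := by
      obtain ⟨r, rfl⟩ := Nat.exists_eq_add_of_le' hq
      simp only [show r + 1 + 1 - 1 = r + 1 by omega,
        show r + 1 + 1 - 2 = r by omega]
      ring

variable [Fintype F] {q : ℕ} {c21 c21s : R2 F} {h : ℕ → R2 F}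

theorem actX_c21s (hF : Fintype.card F = q) (a b c d : F)
    (hcs : d22s F q * c21s = X 2 * X 3 ^ (q ^ 2) - X 3 * X 2 ^ (q ^ 2)) :
    actX a b c d c21s = c21s := by
  apply mul_left_cancel₀ (d22s_ne_zero hF)
  have := congrArg (actX a b c d) hcs
  rw [map_mul, actX_d22s] at this
  rw [this, hcs]
  simp

theorem linearIndependent_invariantBasis (hF : Fintype.card F = q)
    (hc : d22 F q * c21 = X 1 * X 0 ^ (q ^ 2) - X 0 * X 1 ^ (q ^ 2))
    (hcs : d22s F q * c21s = X 2 * X 3 ^ (q ^ 2) - X 3 * X 2 ^ (q ^ 2))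
    (hh : ∀ s ≤ q - 1, u0 F ^ q * h s =
      u1 F q ^ (s + 1) * d22s F q ^ (q - s - 1) + u1s F q ^ (q - s) * d22 F q ^ s) :
    LinearIndependent (Algebra.adjoin F {d22 F q, c21, d22s F q, c21s})
      ((↑) : invariantBasis q h → R2 F) := by
  classical
  obtain ⟨hfin, hcard⟩ := finite_invariantBasis_and_card_le (one_lt_of_card hF) h
  have := hfin.to_subtype
  refine linearIndependent_of_forall_mulStabilizer
    (G := {p : F × F × F × F // p.1 * p.2.2.2 - p.2.1 * p.2.2.1 = 1})
    (Submodule.subset_span (one_mem_invariantBasis q h))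
    (fun g => actX g.1.1 g.1.2.1 g.1.2.2.1 g.1.2.2.2) ?_ ?_
    (hcard.trans (le_card_det_eq_one hF))
  · rintro ⟨⟨a, b, c, d⟩, hg⟩ r hr
    refine (Algebra.adjoin_le (S := AlgHom.equalizer (actX a b c d) (AlgHom.id F _)) ?_) hr
    rintro _ (rfl | rfl | rfl | rfl)
    · exact actX_d22 hF hg
    · exact actX_c21 hF hg hc
    · exact actX_d22s a b c d q
    · exact actX_c21s hF a b c d hcs
  · intro g g' hgg
    exact Subtype.ext (eq_of_actX_u0_eq
      (hgg _ (u0_u1_u1s_mem_mulStabilizer hF hc hcs hh (by simp))))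

theorem mem_span_invariantBasis (hF : Fintype.card F = q)
    (hc : d22 F q * c21 = X 1 * X 0 ^ (q ^ 2) - X 0 * X 1 ^ (q ^ 2))
    (hcs : d22s F q * c21s = X 2 * X 3 ^ (q ^ 2) - X 3 * X 2 ^ (q ^ 2))
    (hh : ∀ s ≤ q - 1, u0 F ^ q * h s =
      u1 F q ^ (s + 1) * d22s F q ^ (q - s - 1) + u1s F q ^ (q - s) * d22 F q ^ s)
    {f : R2 F} (hf : f ∈ invariantRing (SL2 F)) :
    f ∈ Submodule.span (Algebra.adjoin F {d22 F q, c21, d22s F q, c21s})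
      (invariantBasis q h) := by
  have hfin := (finite_invariantBasis_and_card_le (one_lt_of_card hF) h).1
  have := hfin.fintype
  have hli := linearIndependent_invariantBasis hF hc hcs hh
  obtain ⟨n, hn⟩ := exists_d22_pow_mul_mem_span hF hc hcs hh hf
  obtain ⟨m, hm⟩ := exists_d22s_pow_mul_mem_span hF hc hcs hh hf
  set A := Algebra.adjoin F {d22 F q, c21, d22s F q, c21s} with hA
  have hd : d22 F q ∈ A := Algebra.subset_adjoin (by simp)
  have hds : d22s F q ∈ A := Algebra.subset_adjoin (by simp)
  rw [← Subtype.range_coe (s := invariantBasis q h), Submodule.mem_span_range_iff_exists_fun]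
    at hn hm ⊢
  obtain ⟨a, ha⟩ := hn
  obtain ⟨b, hb⟩ := hm
  have hab : ∀ s, d22s F q ^ m * (a s : R2 F) = d22 F q ^ n * b s := by
    intro s
    have h1 : ∑ s, ((⟨d22s F q, hds⟩ : A) ^ m * a s - (⟨d22 F q, hd⟩ : A) ^ n * b s) •
        (s : R2 F) = 0 := by
      simp only [sub_smul, mul_smul, Finset.sum_sub_distrib, ← Finset.smul_sum, ha, hb]
      simp only [Subalgebra.smul_def, SubmonoidClass.coe_pow, smul_eq_mul]
      ring
    have h2 := Fintype.linearIndependent_iff.1 hli _ h1 s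
    simpa using congrArg (Subtype.val) (sub_eq_zero.1 h2)
  choose a' ha' hda using fun s => exists_eq_d22_pow_mul hF hc hcs (a s).2 (b s).2 (hab s)
  refine ⟨fun s => ⟨a' s, ha' s⟩, mul_left_cancel₀ (pow_ne_zero n (d22_ne_zero hF)) ?_⟩
  rw [← ha, Finset.mul_sum]
  refine Finset.sum_congr rfl fun s _ => ?_
  rw [Subalgebra.smul_def, Subalgebra.smul_def, hda, smul_eq_mul, smul_eq_mul, mul_assoc]

end basis

/-- every element of `𝕊` lies in `R₂^{SL₂}`, and `𝕊` is a basis of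
`R₂^{SL₂}` as a free module over `𝒜 = F_q[d₂₂, c₂₁, d₂₂*, c₂₁*]`. -/
theorem stmt_10 (q : ℕ) (hq : IsPrimePow q) (F : Type) [Field F] [Fintype F]
    (hF : Fintype.card F = q)
    (c21 c21s : R2 F)
    (hc21 : d22 F q * c21 = X 1 * X 0 ^ (q ^ 2) - X 0 * X 1 ^ (q ^ 2))
    (hc21s : d22s F q * c21s = X 2 * X 3 ^ (q ^ 2) - X 3 * X 2 ^ (q ^ 2))
    (h : ℕ → R2 F)
    (hh : ∀ s ≤ q - 1, u0 F ^ q * h s =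
      u1 F q ^ (s + 1) * d22s F q ^ (q - s - 1) + u1s F q ^ (q - s) * d22 F q ^ s)
    (𝕊 : Set (R2 F))
    (h𝕊 : 𝕊 =
      {f | ∃ i j, i ≤ q - 1 ∧ j ≤ q - 1 ∧ f = u1s F q ^ i * u1 F q ^ j} ∪
      {f | ∃ i j k, i ≤ q - 2 ∧ j ≤ q - 2 ∧ 1 ≤ k ∧ k ≤ q ∧
        f = u1s F q ^ i * u1 F q ^ j * u0 F ^ k} ∪
      {f | ∃ s k, 1 ≤ s ∧ s ≤ q - 2 ∧ k ≤ q - 1 ∧ f = h s * u0 F ^ k}) :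
    𝕊 ⊆ (invariantRing (SL2 F) : Set (R2 F)) ∧
    (∀ f ∈ invariantRing (SL2 F),
      f ∈ Submodule.span (Algebra.adjoin F {d22 F q, c21, d22s F q, c21s}) 𝕊) ∧
    LinearIndependent (Algebra.adjoin F {d22 F q, c21, d22s F q, c21s})
      (fun b : 𝕊 => (b : R2 F)) := by
  subst h𝕊
  exact ⟨invariantBasis_subset hF hh, fun _ hf => mem_span_invariantBasis hF hc21 hc21s hh hf,
    linearIndependent_invariantBasis hF hc21 hc21s hh⟩
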